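/- Let n ≥ 2, let Ω ⊆ ℝⁿ be any open set, and let μ be a Borel measure on Ω that is α-upper Ahlfors regular with constant C_μ for some α ∈ (n−1, n]. Let X(Ω), Y(Ω, μ) and Z(∂Ω) be rearrangement-invariant spaces (with respect to Lebesgue measure on Ω, μ on Ω, and H^{n−1} on ∂Ω, respectively) such that, for some constant C and every non-increasing function φ: [0,∞) → [0,∞): (1) ‖ s^{−(n−1)/α} ∫_0^{s^{n/α}} φ(r) dr ‖_{Ȳ(0,∞)} ≤ C ‖φ‖_{X̄(0,∞)}, (2) ‖ ∫_{s^{n/α}}^∞ r^{−(n−1)/n} φ(r) dr ‖_{Ȳ(0,∞)} ≤ C ‖φ‖_{X̄(0,∞)}, (3) ‖ s^{−(n−1)/α} ∫_0^{s^{(n−1)/α}} φ(r) dr ‖_{Ȳ(0,∞)} ≤ C ‖φ‖_{Z̄(0,∞)}. Then there exists a constant C' = C'(n, α, C_μ, C) such that ‖u‖_{Y(Ω, μ)} ≤ C' ( ‖Eu‖_{X(Ω)} + ‖u‖_{Z(∂Ω)} ) for every u ∈ E¹X(Ω) ∩ C_b(Ω̄). -/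

import Mathlib

open MeasureTheory Set
open scoped ENNReal NNReal

noncomputable section

/-- Euclidean space `ℝⁿ`. -/
abbrev Euc (n : ℕ) := EuclideanSpace ℝ (Fin n)

/-- The decreasing rearrangement of `f` with respect to the measure `ν`,
`f*_ν(s) = inf { t ≥ 0 : ν({|f| > t}) ≤ s }`. -/
def rearr {α : Type*} [MeasurableSpace α] (ν : Measure α) (f : α → ℝ) (s : ℝ) : ℝ≥0∞ :=
  sInf {t : ℝ≥0∞ | ν {x | t < ENNReal.ofReal |f x|} ≤ ENNReal.ofReal s}

/-- `E : Ω → ℝ^{n×n}` (indexed by pairs, with the euclidean (Frobenius) norm) is the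
distributional symmetric gradient of `u` on the open set `Ω`, with `u` and `E` locally
integrable on `Ω`:  for all test functions `φ` compactly supported in `Ω`,
`∫_Ω (uⁱ ∂_j φ + uʲ ∂_i φ) = -2 ∫_Ω E_{ij} φ`. -/
def IsSymmGradOn (n : ℕ) (Ω : Set (Euc n)) (u : Euc n → Euc n)
    (E : Euc n → EuclideanSpace ℝ (Fin n × Fin n)) : Prop :=
  MeasureTheory.LocallyIntegrableOn u Ω volume ∧
  MeasureTheory.LocallyIntegrableOn E Ω volume ∧
  ∀ φ : Euc n → ℝ, ContDiff ℝ (⊤ : ℕ∞) φ → HasCompactSupport φ → tsupport φ ⊆ Ω →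
    ∀ i j : Fin n,
      (∫ x in Ω, (u x i * fderiv ℝ φ x (EuclideanSpace.single j 1)
          + u x j * fderiv ℝ φ x (EuclideanSpace.single i 1))) =
        - ∫ x in Ω, 2 * E x (i, j) * φ x

/-- Membership in `C_b(Ω̄)`: continuity on `Ω̄` and bounded support. -/
def MemCb (n : ℕ) (Ω : Set (Euc n)) (u : Euc n → Euc n) : Prop :=
  ContinuousOn u (closure Ω) ∧ Bornology.IsBounded {x ∈ closure Ω | u x ≠ 0}

/-- `μ` is `α`-upper Ahlfors regular on `Ω` with constant `Cμ`:
`μ(B_r(x) ∩ Ω) ≤ Cμ rᵅ` for all `x ∈ Ω`, `r > 0`. -/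
def AhlforsUpper (n : ℕ) (Ω : Set (Euc n)) (μ : Measure (Euc n)) (α Cμ : ℝ) : Prop :=
  ∀ x ∈ Ω, ∀ r : ℝ, 0 < r → μ (Metric.ball x r ∩ Ω) ≤ ENNReal.ofReal (Cμ * r ^ α)

/-- The ray from `x` in direction `θ` meets `∂Ω`. -/
def hitsBoundary {n : ℕ} (Ω : Set (Euc n)) (x θ : Euc n) : Prop :=
  ∃ t : ℝ, 0 < t ∧ x + t • θ ∈ frontier Ω

/-- The first time at which the ray from `x` in direction `θ` meets `∂Ω`. -/
def zetaTime {n : ℕ} (Ω : Set (Euc n)) (x θ : Euc n) : ℝ :=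
  sInf {t : ℝ | 0 < t ∧ x + t • θ ∈ frontier Ω}

/-- `ζ(x,θ)`: the first point at which the ray from `x` in direction `θ` meets `∂Ω`
(for an open `Ω`, this is the unique point of `(∂Ω)ₓ` on the ray). -/
def zeta {n : ℕ} (Ω : Set (Euc n)) (x θ : Euc n) : Euc n :=
  x + zetaTime Ω x θ • θ

/-- The Lorentz `L^{p,q}` (quasi-)norm, `‖s^{1/p-1/q} f*(s)‖_{L^q(0,∞)}` (with the usual
supremum expression when `q = ∞`). -/
def lorentzNorm {α : Type*} [MeasurableSpace α] (ν : Measure α) (p : ℝ) (q : ℝ≥0∞)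
    (f : α → ℝ) : ℝ≥0∞ :=
  if q = ⊤ then ⨆ s ∈ Set.Ioi (0 : ℝ), ENNReal.ofReal (s ^ (1 / p)) * rearr ν f s
  else (∫⁻ s in Set.Ioi (0 : ℝ),
      (ENNReal.ofReal (s ^ (1 / p - 1 / q.toReal)) * rearr ν f s) ^ q.toReal) ^ (1 / q.toReal)

/-- The Lorentz–Zygmund `L^{∞,q;-1}` norm,
`‖s^{-1/q} (log(1 + ν(R)/s))⁻¹ f*(s)‖_{L^q(0, ν(R))}`. -/
def lorentzZygmundNorm {α : Type*} [MeasurableSpace α] (ν : Measure α) (q : ℝ)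
    (f : α → ℝ) : ℝ≥0∞ :=
  (∫⁻ s in Set.Ioo (0 : ℝ) (ν Set.univ).toReal,
      (ENNReal.ofReal (s ^ (-(1 / q)) * (Real.log (1 + (ν Set.univ).toReal / s))⁻¹)
        * rearr ν f s) ^ q) ^ (1 / q)

/-- The Luxemburg (Orlicz) norm associated with the Young-type function `A`. -/
def luxemburgNorm {α : Type*} [MeasurableSpace α] (ν : Measure α) (A : ℝ → ℝ)
    (f : α → ℝ) : ℝ≥0∞ :=
  sInf (ENNReal.ofReal ''
    {lam : ℝ | 0 < lam ∧ ∫⁻ x, ENNReal.ofReal (A (|f x| / lam)) ∂ν ≤ 1})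

/-- `A(t) = e^{t^σ} - 1`, the Young function of the exponential space `exp L^σ`. -/
def expYoung (σ t : ℝ) : ℝ := Real.exp (t ^ σ) - 1

/-- `A(t) = e^{e^{t^σ}} - e`, the Young function of the space `exp exp L^σ`. -/
def expexpYoung (σ t : ℝ) : ℝ := Real.exp (Real.exp (t ^ σ)) - Real.exp 1

/-- `A(t) = t^p log^σ(1+t)`, the Young function of the Zygmund space `L^p (log L)^σ`. -/
def zygYoung (p σ t : ℝ) : ℝ := t ^ p * Real.log (1 + t) ^ σ

/-- An abstract rearrangement-invariant function norm on `(0,∞)` (the representation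
norm of a rearrangement-invariant space), recorded together with the properties of such
norms used here: monotonicity, subadditivity, homogeneity and boundedness of dilations. -/
structure RINorm where
  N : (ℝ → ℝ≥0∞) → ℝ≥0∞
  mono : ∀ f g : ℝ → ℝ≥0∞, (∀ s, 0 < s → f s ≤ g s) → N f ≤ N g
  add_le : ∀ f g : ℝ → ℝ≥0∞, N (fun s => f s + g s) ≤ N f + N g
  smul_le : ∀ (c : ℝ≥0∞) (f : ℝ → ℝ≥0∞), N (fun s => c * f s) ≤ c * N f
  dilate : ∀ c : ℝ, 0 < c → ∀ f : ℝ → ℝ≥0∞,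
    N (fun s => f (c * s)) ≤ ENNReal.ofReal (max 1 c⁻¹) * N f


section Rearrangement

variable {β : Type*} [MeasurableSpace β] (ν : Measure β) (f : β → ℝ)

lemma rearr_antitone {s t : ℝ} (h : s ≤ t) : rearr ν f t ≤ rearr ν f s :=
  sInf_le_sInf fun _ ht => le_trans ht (ENNReal.ofReal_le_ofReal h)

lemma rearr_le {s : ℝ} {t : ℝ≥0∞}
    (h : ν {x | t < ENNReal.ofReal |f x|} ≤ ENNReal.ofReal s) : rearr ν f s ≤ t :=
  sInf_le h

lemma le_rearr {s : ℝ} {t : ℝ≥0∞}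
    (h : ENNReal.ofReal s < ν {x | t < ENNReal.ofReal |f x|}) : t ≤ rearr ν f s := by
  refine le_sInf fun b hb => ?_
  by_contra! hlt
  refine absurd (h.trans_le ((measure_mono fun x hx => ?_).trans hb)) (lt_irrefl _)
  exact hlt.trans hx

/-- The infimum defining the decreasing rearrangement is attained. -/
lemma measure_rearr_lt_le (s : ℝ) :
    ν {x | rearr ν f s < ENNReal.ofReal |f x|} ≤ ENNReal.ofReal s := by
  set A : Set ℝ≥0∞ := {t : ℝ≥0∞ | ν {x | t < ENNReal.ofReal |f x|} ≤ ENNReal.ofReal s} with hA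
  have hne : A.Nonempty := ⟨⊤, by simp [hA]⟩
  obtain ⟨t, ht, hlim, hmem⟩ := exists_seq_tendsto_sInf hne (OrderBot.bddBelow A)
  have hU : {x | rearr ν f s < ENNReal.ofReal |f x|} ⊆
      ⋃ j, {x | t j < ENNReal.ofReal |f x|} := by
    intro x hx
    obtain ⟨j, hj⟩ := (hlim.eventually (gt_mem_nhds (show sInf A < _ from hx))).exists
    exact mem_iUnion.2 ⟨j, hj⟩
  refine (measure_mono hU).trans ?_
  rw [Monotone.measure_iUnion]
  · exact iSup_le hmem
  · intro i j hij x hx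
    exact lt_of_le_of_lt (ht hij) hx

lemma rearr_mono {f g : β → ℝ} (h : ∀ x, |f x| ≤ |g x|) (s : ℝ) : rearr ν f s ≤ rearr ν g s :=
  sInf_le_sInf fun _ ht => (measure_mono fun _ hx =>
    lt_of_lt_of_le hx (ENNReal.ofReal_le_ofReal (h _))).trans ht

lemma rearr_congr_ae {f g : β → ℝ} (h : f =ᵐ[ν] g) (s : ℝ) : rearr ν f s = rearr ν g s := by
  have : ∀ t : ℝ≥0∞, ν {x | t < ENNReal.ofReal |f x|} = ν {x | t < ENNReal.ofReal |g x|} := by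
    intro t
    refine measure_congr ?_
    filter_upwards [h] with x hx
    change (t < ENNReal.ofReal |f x|) = (t < ENNReal.ofReal |g x|)
    rw [hx]
  simp only [rearr, this]

lemma volume_pos_ofReal_le (a : ℝ≥0∞) : volume {t : ℝ | 0 < t ∧ ENNReal.ofReal t ≤ a} ≤ a := by
  rcases eq_or_ne a ⊤ with rfl | ha
  · exact le_top
  · calc volume {t : ℝ | 0 < t ∧ ENNReal.ofReal t ≤ a} ≤ volume (Ioc 0 a.toReal) := by
          refine measure_mono fun t ht => ⟨ht.1, (ENNReal.ofReal_le_iff_le_toReal ha).1 ht.2⟩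
      _ = a := by rw [Real.volume_Ioc, sub_zero, ENNReal.ofReal_toReal ha]

/-- Exchanging the roles of the distribution function and of the decreasing rearrangement. -/
lemma lintegral_measure_lt_distribution_le (hf : ∀ x, 0 ≤ f x) (W : Measure ℝ) [SFinite W] :
    ∫⁻ t in Ioi (0 : ℝ), W {r | ENNReal.ofReal r < ν {x | t < f x}} ≤
      ∫⁻ r, rearr ν f r ∂W := by
  have hanti : Antitone fun t : ℝ => ν {x | t < f x} :=
    fun a b hab => measure_mono fun x hx => lt_of_le_of_lt hab hx
  have hmeas : MeasurableSet {q : ℝ × ℝ | ENNReal.ofReal q.2 < ν {x | q.1 < f x}} :=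
    measurableSet_lt (ENNReal.measurable_ofReal.comp measurable_snd)
      (hanti.measurable.comp measurable_fst)
  calc ∫⁻ t in Ioi (0 : ℝ), W {r | ENNReal.ofReal r < ν {x | t < f x}}
      = ((volume.restrict (Ioi (0 : ℝ))).prod W)
          {q : ℝ × ℝ | ENNReal.ofReal q.2 < ν {x | q.1 < f x}} :=
        (Measure.prod_apply hmeas).symm
    _ = ∫⁻ r, (volume.restrict (Ioi (0 : ℝ))) {t | ENNReal.ofReal r < ν {x | t < f x}} ∂W :=
        Measure.prod_apply_symm hmeas
    _ ≤ ∫⁻ r, rearr ν f r ∂W := by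
        refine lintegral_mono fun r => ?_
        rw [Measure.restrict_apply' measurableSet_Ioi]
        refine (measure_mono ?_).trans (volume_pos_ofReal_le (rearr ν f r))
        rintro t ⟨ht, ht0⟩
        refine ⟨ht0, le_rearr ν f (lt_of_lt_of_le ht (measure_mono fun x hx => ?_))⟩
        change ENNReal.ofReal t < ENNReal.ofReal |f x|
        rw [abs_of_nonneg (hf x)]
        exact (ENNReal.ofReal_lt_ofReal_iff (lt_trans (mem_Ioi.1 ht0) hx)).2 hx

/-- The part of `f` above the level `k` has integral at most `∫₀^σ f*`, if `{f > k}` has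
measure at most `σ`. -/
lemma lintegral_sub_level_le (hf : ∀ x, 0 ≤ f x) (hfm : Measurable f) {σ k : ℝ} (hk : 0 ≤ k)
    (h : ν {x | k < f x} ≤ ENNReal.ofReal σ) :
    ∫⁻ x, ENNReal.ofReal (f x - k) ∂ν ≤ ∫⁻ r in Ioc 0 σ, rearr ν f r := by
  set g : β → ℝ := fun x => max (f x - k) 0 with hg
  have hg0 : ∀ x, 0 ≤ g x := fun x => le_max_right _ _
  have hgm : Measurable g := (hfm.sub_const k).max measurable_const
  have e1 : ∀ x, ENNReal.ofReal (f x - k) = ENNReal.ofReal (g x) := fun x => by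
    simp [hg, ENNReal.ofReal_max]
  simp_rw [e1]
  rw [lintegral_eq_lintegral_meas_lt ν (Filter.Eventually.of_forall hg0) hgm.aemeasurable]
  calc ∫⁻ t in Ioi 0, ν {a | t < g a}
      ≤ ∫⁻ t in Ioi (0 : ℝ), (volume.restrict (Ioc 0 σ))
          {r | ENNReal.ofReal r < ν {x | t < g x}} := by
        refine setLIntegral_mono' measurableSet_Ioi fun t ht => ?_
        have hle : ν {a | t < g a} ≤ ENNReal.ofReal σ := by
          refine (measure_mono fun x hx => ?_).trans h
          have hx' : t < max (f x - k) 0 := hx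
          rcases lt_max_iff.1 hx' with h' | h'
          · have := mem_Ioi.1 ht
            simp only [mem_ofPred_eq]; linarith
          · exact absurd h' (not_lt.2 (le_of_lt ht))
        have hfin : ν {a | t < g a} ≠ ⊤ := ne_top_of_le_ne_top ENNReal.ofReal_ne_top hle
        rw [Measure.restrict_apply' measurableSet_Ioc]
        calc ν {a | t < g a} = volume (Ioo 0 (ν {a | t < g a}).toReal) := by
              rw [Real.volume_Ioo, sub_zero, ENNReal.ofReal_toReal hfin]
          _ ≤ _ := by
              refine measure_mono fun r hr => ⟨?_, hr.1, ?_⟩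
              · exact (ENNReal.ofReal_lt_iff_lt_toReal hr.1.le hfin).2 hr.2
              · by_contra! hlt
                have : (ν {a | t < g a}).toReal ≤ σ := by
                  have hσ : 0 ≤ σ := by
                    by_contra! hneg
                    rw [ENNReal.ofReal_of_nonpos hneg.le, nonpos_iff_eq_zero] at hle
                    have := hr.1.trans hr.2
                    rw [hle] at this
                    simp at this
                  exact ENNReal.toReal_le_of_le_ofReal hσ hle
                linarith [hr.2]
    _ ≤ ∫⁻ r in Ioc 0 σ, rearr ν g r := lintegral_measure_lt_distribution_le ν g hg0 _
    _ ≤ ∫⁻ r in Ioc 0 σ, rearr ν f r := by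
        refine lintegral_mono fun r => rearr_mono ν (fun x => ?_) r
        rw [abs_of_nonneg (hg0 x), abs_of_nonneg (hf x)]
        exact max_le (by linarith) (hf x)

end Rearrangement

lemma lintegral_Ioc_rpow_sub_one {q a b : ℝ} (hq : 0 < q) (ha : 0 < a) (hab : a ≤ b) :
    ∫⁻ r in Ioc a b, ENNReal.ofReal (r ^ (q - 1)) = ENNReal.ofReal ((b ^ q - a ^ q) / q) := by
  have hint : IntervalIntegrable (fun r : ℝ => r ^ (q - 1)) volume a b :=
    intervalIntegral.intervalIntegrable_rpow' (by linarith)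
  rw [← ofReal_integral_eq_lintegral_ofReal, ← intervalIntegral.integral_of_le hab,
    integral_rpow (Or.inl (by linarith))]
  · simp
  · exact (intervalIntegrable_iff_integrableOn_Ioc_of_le hab).1 hint
  · filter_upwards [ae_restrict_mem measurableSet_Ioc] with r hr
    exact Real.rpow_nonneg (ha.le.trans hr.1.le) _

/-- The weight `r^{q-1}` on `(σ,∞)`. -/
def tailWeight (q σ : ℝ) : Measure ℝ :=
  (volume.restrict (Ioi σ)).withDensity fun r => ENNReal.ofReal (r ^ (q - 1))

instance (q σ : ℝ) : SFinite (tailWeight q σ) := by unfold tailWeight; infer_instance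

lemma rpow_le_add_tailWeight {q σ : ℝ} (hq : 0 < q) (hσ : 0 < σ) (a : ℝ≥0∞) :
    a ^ q ≤ ENNReal.ofReal (σ ^ q) +
      ENNReal.ofReal q * tailWeight q σ {r | ENNReal.ofReal r < a} := by
  set R := ENNReal.ofReal (σ ^ q) +
      ENNReal.ofReal q * tailWeight q σ {r | ENNReal.ofReal r < a} with hR
  suffices h : a ≤ R ^ (1 / q) by
    calc a ^ q ≤ (R ^ (1 / q)) ^ q := ENNReal.rpow_le_rpow h hq.le
      _ = R := by rw [← ENNReal.rpow_mul, one_div_mul_cancel hq.ne', ENNReal.rpow_one]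
  refine ENNReal.le_of_forall_nnreal_lt fun b hb => ?_
  suffices h : (b : ℝ≥0∞) ^ q ≤ R by
    calc (b : ℝ≥0∞) = ((b : ℝ≥0∞) ^ q) ^ (1 / q) := by
          rw [← ENNReal.rpow_mul, mul_one_div_cancel hq.ne', ENNReal.rpow_one]
      _ ≤ R ^ (1 / q) := ENNReal.rpow_le_rpow h (by positivity)
  have hbq : (b : ℝ≥0∞) ^ q = ENNReal.ofReal ((b : ℝ) ^ q) := by
    rw [← ENNReal.ofReal_coe_nnreal, ENNReal.ofReal_rpow_of_nonneg b.coe_nonneg hq.le]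
  rw [hbq]
  rcases le_total (b : ℝ) σ with hbσ | hbσ
  · exact (ENNReal.ofReal_le_ofReal (Real.rpow_le_rpow b.2 hbσ hq.le)).trans le_self_add
  · have hW : ENNReal.ofReal (((b : ℝ) ^ q - σ ^ q) / q) ≤
        tailWeight q σ {r | ENNReal.ofReal r < a} := by
      rw [← lintegral_Ioc_rpow_sub_one hq hσ hbσ, tailWeight, withDensity_apply',
        Measure.restrict_restrict' measurableSet_Ioi]
      refine lintegral_mono_set fun r hr => ⟨?_, hr.1⟩
      refine lt_of_le_of_lt ?_ hb
      rw [← ENNReal.ofReal_coe_nnreal]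
      exact ENNReal.ofReal_le_ofReal hr.2
    calc ENNReal.ofReal ((b : ℝ) ^ q)
        ≤ ENNReal.ofReal (σ ^ q) +
            ENNReal.ofReal q * ENNReal.ofReal (((b : ℝ) ^ q - σ ^ q) / q) := by
          rw [← ENNReal.ofReal_mul hq.le, mul_div_cancel₀ _ hq.ne', ← ENNReal.ofReal_add]
          · simp
          · positivity
          · exact sub_nonneg.2 (Real.rpow_le_rpow hσ.le hbσ hq.le)
      _ ≤ R := by
          rw [hR]
          exact add_le_add le_rfl (mul_le_mul_right hW _)

/-- The part of `f` below the level `k` integrated against a measure `m` which is controlled by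
the power `q` of `ν`. -/
lemma lintegral_min_level_le {β : Type*} [MeasurableSpace β] (ν m : Measure β) (f : β → ℝ)
    (hf : ∀ x, 0 ≤ f x) (hfm : Measurable f) {q σ k : ℝ} (hq : 0 < q) (hσ : 0 < σ) (hk : 0 ≤ k)
    {A : ℝ≥0∞} (hm : ∀ F, MeasurableSet F → m F ≤ A * ν F ^ q) :
    ∫⁻ x, ENNReal.ofReal (min (f x) k) ∂m ≤
      A * (ENNReal.ofReal (σ ^ q * k) + ENNReal.ofReal q *
        ∫⁻ r in Ioi σ, ENNReal.ofReal (r ^ (q - 1)) * rearr ν f r) := by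
  rw [lintegral_eq_lintegral_meas_lt m (Filter.Eventually.of_forall fun x => le_min (hf x) hk)
    (hfm.min measurable_const).aemeasurable]
  have hanti : Antitone fun t : ℝ => ν {x | t < f x} :=
    fun a b hab => measure_mono fun x hx => lt_of_le_of_lt hab hx
  calc ∫⁻ t in Ioi (0 : ℝ), m {a | t < min (f a) k}
      ≤ ∫⁻ t in Ioi (0 : ℝ), A * ((Ioc 0 k).indicator (fun _ => ENNReal.ofReal (σ ^ q)) t +
          ENNReal.ofReal q * tailWeight q σ {r | ENNReal.ofReal r < ν {x | t < f x}}) := by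
        refine setLIntegral_mono' measurableSet_Ioi fun t ht => ?_
        by_cases htk : t < k
        · rw [indicator_of_mem (show t ∈ Ioc 0 k from ⟨ht, htk.le⟩)]
          calc m {a | t < min (f a) k} ≤ m {a | t < f a} :=
                measure_mono fun x (hx : t < min (f x) k) => lt_of_lt_of_le hx (min_le_left _ _)
            _ ≤ A * ν {a | t < f a} ^ q := hm _ (measurableSet_lt measurable_const hfm)
            _ ≤ _ := by gcongr; exact rpow_le_add_tailWeight hq hσ _
        · have : {a | t < min (f a) k} = ∅ := by
            ext x
            simp only [mem_ofPred_eq, mem_empty_iff_false, iff_false, not_lt]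
            exact (min_le_right _ _).trans (not_lt.1 htk)
          rw [this, measure_empty]
          exact zero_le
    _ ≤ A * (ENNReal.ofReal (σ ^ q * k) +
          ENNReal.ofReal q * ∫⁻ r, rearr ν f r ∂tailWeight q σ) := by
        have hW : Measurable fun t : ℝ =>
            tailWeight q σ {r | ENNReal.ofReal r < ν {x | t < f x}} := by
          refine Antitone.measurable fun a b hab => measure_mono fun r hr => ?_
          exact lt_of_lt_of_le hr (hanti hab)
        rw [lintegral_const_mul _ (by
            refine Measurable.add (measurable_const.indicator measurableSet_Ioc) (hW.const_mul _)),
          lintegral_add_left (measurable_const.indicator measurableSet_Ioc),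
          lintegral_const_mul _ hW]
        refine mul_le_mul_right (add_le_add ?_ (mul_le_mul_right
          (lintegral_measure_lt_distribution_le ν f hf _) _)) _
        · rw [lintegral_indicator measurableSet_Ioc, lintegral_const,
            ENNReal.ofReal_mul (by positivity), Measure.restrict_restrict measurableSet_Ioc,
            Measure.restrict_apply MeasurableSet.univ, univ_inter]
          gcongr
          refine (measure_mono inter_subset_left).trans ?_
          simp
    _ = _ := by
        rw [tailWeight, lintegral_withDensity_eq_lintegral_mul]
        · rfl
        · fun_prop
        · exact Antitone.measurable fun a b hab => rearr_antitone ν f hab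

/-- The Riesz kernel `|x - y|^{1-n}`, with the value `0` on the diagonal. -/
def rieszKernel (n : ℕ) (x y : Euc n) : ℝ≥0∞ := ENNReal.ofReal ((‖x - y‖ ^ (n - 1))⁻¹)

lemma rieszKernel_comm {n : ℕ} (x y : Euc n) : rieszKernel n x y = rieszKernel n y x := by
  rw [rieszKernel, rieszKernel, norm_sub_rev]

lemma measurable_rieszKernel (n : ℕ) :
    Measurable fun q : Euc n × Euc n => rieszKernel n q.1 q.2 := by
  unfold rieszKernel
  fun_prop

@[fun_prop]
lemma measurable_rieszKernel_right {n : ℕ} (x : Euc n) : Measurable (rieszKernel n x) := by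
  unfold rieszKernel
  fun_prop

/-- Integrals of the Riesz kernel with respect to a measure with growth of order `p (n - 1)`. -/
lemma lintegral_rieszKernel_le {n : ℕ} (hn : 2 ≤ n) {p A : ℝ} (hp : 1 < p) (hA : 0 ≤ A)
    (μ : Measure (Euc n)) (y : Euc n)
    (hμ : ∀ r : ℝ, 0 < r → μ (Metric.ball y r) ≤ ENNReal.ofReal (A * r ^ (p * ((n : ℝ) - 1))))
    (F : Set (Euc n)) :
    ∫⁻ x in F, rieszKernel n x y ∂μ ≤ ENNReal.ofReal (1 + A / (p - 1)) * μ F ^ (1 - 1 / p) := by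
  have hd : (0 : ℝ) < (n : ℝ) - 1 := by
    have : (2 : ℝ) ≤ n := by exact_mod_cast hn
    linarith
  have hcast : ((n - 1 : ℕ) : ℝ) = (n : ℝ) - 1 := by rw [Nat.cast_sub (by omega)]; simp
  have hpp : 0 < 1 - 1 / p := by
    rw [sub_pos, div_lt_one (by linarith)]; exact hp
  have hA' : 0 ≤ A / (p - 1) := div_nonneg hA (by linarith)
  rcases eq_or_ne (μ F) 0 with h0 | h0
  · rw [Measure.restrict_eq_zero.2 h0, lintegral_zero_measure]
    exact zero_le
  rcases eq_or_ne (μ F) ⊤ with htop | htop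
  · rw [htop, ENNReal.top_rpow_of_pos hpp, ENNReal.mul_top]
    · exact le_top
    · rw [Ne, ENNReal.ofReal_eq_zero]; linarith
  set m := (μ F).toReal with hm
  have hm0 : 0 < m := ENNReal.toReal_pos h0 htop
  have hFm : μ F = ENNReal.ofReal m := (ENNReal.ofReal_toReal htop).symm
  set T : ℝ := m ^ (-(1 / p)) with hT
  have hT0 : 0 < T := Real.rpow_pos_of_pos hm0 _
  unfold rieszKernel
  rw [lintegral_eq_lintegral_meas_lt (μ.restrict F)
    (Filter.Eventually.of_forall fun x => by positivity) (by fun_prop)]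
  have hlevel : ∀ t : ℝ, 0 < t →
      (μ.restrict F) {a | t < (‖a - y‖ ^ (n - 1))⁻¹} ≤ ENNReal.ofReal (A * t ^ (-p)) := by
    intro t ht
    set r : ℝ := (t⁻¹) ^ (1 / ((n : ℝ) - 1)) with hr
    have hr0 : 0 < r := Real.rpow_pos_of_pos (inv_pos.2 ht) _
    have hsub : {a | t < (‖a - y‖ ^ (n - 1))⁻¹} ⊆ Metric.ball y r := by
      intro a (ha : t < (‖a - y‖ ^ (n - 1))⁻¹)
      have h1 : 0 < ‖a - y‖ ^ (n - 1) := inv_pos.1 (ht.trans ha)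
      have h2 : ‖a - y‖ ^ (n - 1) < t⁻¹ := (lt_inv_comm₀ ht h1).1 ha
      have h3 : r ^ (n - 1) = t⁻¹ := by
        rw [← Real.rpow_natCast, hcast, hr, ← Real.rpow_mul (by positivity),
          one_div_mul_cancel hd.ne', Real.rpow_one]
      rw [← h3] at h2
      rw [Metric.mem_ball, dist_eq_norm]
      exact lt_of_pow_lt_pow_left₀ _ hr0.le h2
    refine (Measure.restrict_apply_le _ _).trans ((measure_mono hsub).trans ((hμ r hr0).trans ?_))
    refine ENNReal.ofReal_le_ofReal (le_of_eq ?_)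
    rw [hr, ← Real.rpow_mul (by positivity), Real.inv_rpow ht.le, Real.rpow_neg ht.le]
    congr 3
    field_simp
  have hsplit : Ioi (0 : ℝ) = Ioc 0 T ∪ Ioi T := (Ioc_union_Ioi_eq_Ioi hT0.le).symm
  rw [hsplit, lintegral_union measurableSet_Ioi (Ioc_disjoint_Ioi le_rfl)]
  have hfirst : ∫⁻ t in Ioc 0 T, (μ.restrict F) {a | t < (‖a - y‖ ^ (n - 1))⁻¹} ≤
      ENNReal.ofReal (m * T) := by
    calc _ ≤ ∫⁻ t in Ioc 0 T, μ F := by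
          refine lintegral_mono fun t => ?_
          exact (measure_mono (subset_univ _)).trans (by simp)
      _ = ENNReal.ofReal (m * T) := by
          rw [lintegral_const, Measure.restrict_apply MeasurableSet.univ, univ_inter,
            Real.volume_Ioc, sub_zero, hFm, ENNReal.ofReal_mul hm0.le]
  have hsecond : ∫⁻ t in Ioi T, (μ.restrict F) {a | t < (‖a - y‖ ^ (n - 1))⁻¹} ≤
      ENNReal.ofReal (A / (p - 1) * T ^ (1 - p)) := by
    calc _ ≤ ∫⁻ t in Ioi T, ENNReal.ofReal (A * t ^ (-p)) :=
          setLIntegral_mono' measurableSet_Ioi fun t ht => hlevel t (hT0.trans ht)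
      _ = ENNReal.ofReal (A / (p - 1) * T ^ (1 - p)) := by
          rw [← ofReal_integral_eq_lintegral_ofReal, integral_const_mul,
            integral_Ioi_rpow_of_lt (by linarith) hT0]
          · congr 1
            have e : -p + 1 = 1 - p := by ring
            have e' : (1 : ℝ) - p ≠ 0 := by linarith
            have e'' : p - 1 ≠ 0 := by linarith
            rw [e]
            field_simp
            ring
          · exact (integrableOn_Ioi_rpow_of_lt (by linarith) hT0).const_mul A
          · filter_upwards [ae_restrict_mem measurableSet_Ioi] with t ht
            have : 0 < t := hT0.trans ht
            positivity
  refine (add_le_add hfirst hsecond).trans (le_of_eq ?_)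
  have e1 : m * T = m ^ (1 - 1 / p) := by
    rw [hT, sub_eq_add_neg, Real.rpow_add hm0, Real.rpow_one]
  have e2 : T ^ (1 - p) = m ^ (1 - 1 / p) := by
    rw [hT, ← Real.rpow_mul hm0.le]
    congr 1
    have : p ≠ 0 := by linarith
    field_simp
    ring
  rw [e1, e2, hFm, ENNReal.ofReal_rpow_of_pos hm0, ← ENNReal.ofReal_add (by positivity)
    (by positivity), ← ENNReal.ofReal_mul (by positivity)]
  congr 1
  ring

/-- Weak-type estimate for Riesz potentials of finite measures. -/
lemma measure_rieszPotential_gt_le {n : ℕ} (hn : 2 ≤ n) {p A : ℝ} (hp : 1 < p) (hA : 0 ≤ A)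
    (μ : Measure (Euc n))
    (hμ : ∀ y : Euc n, ∀ r : ℝ, 0 < r →
      μ (Metric.ball y r) ≤ ENNReal.ofReal (A * r ^ (p * ((n : ℝ) - 1))))
    (m : Measure (Euc n)) [SFinite m] {l c : ℝ≥0∞} (hl : l ≠ ⊤)
    (hlc : ENNReal.ofReal (1 + A / (p - 1)) * m univ ≤ l * c) :
    μ {x | l < ∫⁻ y, rieszKernel n x y ∂m} ≤ c ^ p := by
  have hp0 : 0 < p := by linarith
  have : IsLocallyFiniteMeasure μ :=
    ⟨fun x => ⟨Metric.ball x 1, Metric.ball_mem_nhds x one_pos,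
      (hμ x 1 one_pos).trans_lt ENNReal.ofReal_lt_top⟩⟩
  have hmeas : MeasurableSet {x | l < ∫⁻ y, rieszKernel n x y ∂m} :=
    measurableSet_lt measurable_const (measurable_rieszKernel n).lintegral_prod_right'
  set S := {x | l < ∫⁻ y, rieszKernel n x y ∂m} with hS
  have key : ∀ j : ℕ, μ (S ∩ Metric.ball 0 j) ≤ c ^ p := by
    intro j
    set F := S ∩ Metric.ball 0 (j : ℝ) with hF
    have hFm : MeasurableSet F := hmeas.inter measurableSet_ball
    have hFtop : μ F ≠ ⊤ :=
      ((measure_mono inter_subset_right).trans_lt Metric.isBounded_ball.measure_lt_top).ne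
    rcases eq_or_ne (μ F) 0 with h0 | h0
    · rw [h0]; exact zero_le
    have hswap : ∫⁻ x in F, ∫⁻ y, rieszKernel n x y ∂m ∂μ =
        ∫⁻ y, ∫⁻ x in F, rieszKernel n x y ∂μ ∂m :=
      lintegral_lintegral_swap (measurable_rieszKernel n).aemeasurable
    have hupper : ∫⁻ x in F, ∫⁻ y, rieszKernel n x y ∂m ∂μ ≤ l * c * μ F ^ (1 - 1 / p) := by
      rw [hswap]
      calc ∫⁻ y, ∫⁻ x in F, rieszKernel n x y ∂μ ∂m
          ≤ ∫⁻ y, ENNReal.ofReal (1 + A / (p - 1)) * μ F ^ (1 - 1 / p) ∂m :=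
            lintegral_mono fun y => lintegral_rieszKernel_le hn hp hA μ y (hμ y) F
        _ = ENNReal.ofReal (1 + A / (p - 1)) * m univ * μ F ^ (1 - 1 / p) := by
            rw [lintegral_const]; ring
        _ ≤ _ := by gcongr
    rcases eq_or_ne l 0 with hl0 | hl0
    · exfalso
      rw [hl0, zero_mul, zero_mul, nonpos_iff_eq_zero,
        lintegral_eq_zero_iff (measurable_rieszKernel n).lintegral_prod_right'] at hupper
      have hall : ∀ᵐ x ∂μ.restrict F, False := by
        filter_upwards [hupper, ae_restrict_mem hFm] with x hx hxF
        have : l < ∫⁻ y, rieszKernel n x y ∂m := hxF.1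
        rw [hx] at this
        exact absurd this (by simp)
      rw [Filter.eventually_false_iff_eq_bot, ae_eq_bot, Measure.restrict_eq_zero] at hall
      exact h0 hall
    have hlower : l * μ F ≤ ∫⁻ x in F, ∫⁻ y, rieszKernel n x y ∂m ∂μ := by
      rw [← setLIntegral_const]
      exact setLIntegral_mono' hFm fun x hx => le_of_lt hx.1
    have h1 : μ F ≤ c * μ F ^ (1 - 1 / p) := by
      have := hlower.trans hupper
      rw [mul_assoc] at this
      exact (ENNReal.mul_le_mul_iff_right hl0 hl).1 this
    have h2 : μ F ^ (1 / p) ≤ c := by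
      have e : μ F = μ F ^ (1 / p) * μ F ^ (1 - 1 / p) := by
        rw [← ENNReal.rpow_add _ _ h0 hFtop]; simp
      rw [e, ← e] at h1
      have hne : μ F ^ (1 - 1 / p) ≠ 0 := by
        rw [Ne, ENNReal.rpow_eq_zero_iff]; tauto
      have hne' : μ F ^ (1 - 1 / p) ≠ ⊤ := by
        refine ENNReal.rpow_ne_top_of_nonneg ?_ hFtop
        rw [sub_nonneg, div_le_one hp0]; exact hp.le
      exact (ENNReal.mul_le_mul_iff_left hne hne').1 (e ▸ h1)
    calc μ F = (μ F ^ (1 / p)) ^ p := by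
          rw [← ENNReal.rpow_mul, one_div_mul_cancel hp0.ne', ENNReal.rpow_one]
      _ ≤ c ^ p := ENNReal.rpow_le_rpow h2 hp0.le
  have hU : S = ⋃ j : ℕ, S ∩ Metric.ball 0 (j : ℝ) := by
    rw [← inter_iUnion, Metric.iUnion_ball_nat, inter_univ]
  rw [hU, Monotone.measure_iUnion]
  · exact iSup_le key
  · exact fun i j hij =>
      inter_subset_inter_right _ (Metric.ball_subset_ball (by exact_mod_cast hij))

/-- The constant of the growth condition of Lebesgue measure. -/
def ballVol (n : ℕ) : ℝ := (volume (Metric.ball (0 : Euc n) 1)).toReal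

lemma ballVol_pos (n : ℕ) : 0 < ballVol n :=
  ENNReal.toReal_pos (Metric.measure_ball_pos _ _ one_pos).ne' measure_ball_lt_top.ne

lemma volume_ball_eq {n : ℕ} (y : Euc n) {r : ℝ} (hr : 0 < r) :
    volume (Metric.ball y r) = ENNReal.ofReal (ballVol n * r ^ n) := by
  rw [Measure.addHaar_ball_of_pos _ _ hr, finrank_euclideanSpace_fin, mul_comm,
    ENNReal.ofReal_mul (ballVol_pos n).le, ballVol, ENNReal.ofReal_toReal measure_ball_lt_top.ne]

lemma volume_lintegral_rieszKernel_le {n : ℕ} (hn : 2 ≤ n) (y : Euc n) (F : Set (Euc n)) :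
    ∫⁻ x in F, rieszKernel n x y ≤
      ENNReal.ofReal (1 + ballVol n * (n - 1)) * volume F ^ (1 / (n : ℝ)) := by
  have h2 : (2 : ℝ) ≤ n := by exact_mod_cast hn
  have h := lintegral_rieszKernel_le hn (p := n / ((n : ℝ) - 1)) (A := ballVol n)
    (by rw [lt_div_iff₀ (by linarith)]; linarith) (ballVol_pos n).le volume y (by
      intro r hr
      rw [volume_ball_eq y hr, div_mul_cancel₀ _ (by linarith), Real.rpow_natCast]) F
  have e1 : ballVol n / ((n : ℝ) / ((n : ℝ) - 1) - 1) = ballVol n * (n - 1) := by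
    have : (n : ℝ) - 1 ≠ 0 := by linarith
    have h3 : (n : ℝ) / ((n : ℝ) - 1) - 1 = 1 / ((n : ℝ) - 1) := by field_simp; ring
    rw [h3]; field_simp
  have e2 : 1 - 1 / ((n : ℝ) / ((n : ℝ) - 1)) = 1 / (n : ℝ) := by
    have : (n : ℝ) ≠ 0 := by linarith
    field_simp
    ring
  rwa [e1, e2] at h

/-- Scaling estimate: integrals over cones of directions are controlled by the Riesz kernel. -/
lemma lintegral_directions_le {n : ℕ} (hn : 2 ≤ n) (x : Euc n) (F : Euc n → ℝ≥0∞)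
    (hF : Measurable F) :
    ∫⁻ v in {v : Euc n | 1 ≤ ‖v‖ ∧ ‖v‖ ≤ 2}, ∫⁻ t in Ioi (0 : ℝ), F (x + t • v) ≤
      2 ^ (n - 1) * ∫⁻ y, F y * rieszKernel n x y := by
  have hD : MeasurableSet {v : Euc n | 1 ≤ ‖v‖ ∧ ‖v‖ ≤ 2} :=
    (measurableSet_le measurable_const measurable_norm).inter
      (measurableSet_le measurable_norm measurable_const)
  set D := {v : Euc n | 1 ≤ ‖v‖ ∧ ‖v‖ ≤ 2} with hDdef
  have hm1 : Measurable fun q : Euc n × ℝ => F (x + q.2 • q.1) := by fun_prop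
  rw [lintegral_lintegral_swap hm1.aemeasurable]
  have hset : MeasurableSet {q : ℝ × Euc n | q.1 ≤ ‖q.2 - x‖ ∧ ‖q.2 - x‖ ≤ 2 * q.1} := by
    have h1 : Measurable fun q : ℝ × Euc n => ‖q.2 - x‖ := by fun_prop
    exact (measurableSet_le measurable_fst h1).inter
      (measurableSet_le h1 (measurable_fst.const_mul 2))
  have hite : Measurable fun q : ℝ × Euc n =>
      if q.1 ≤ ‖q.2 - x‖ ∧ ‖q.2 - x‖ ≤ 2 * q.1 then (1 : ℝ≥0∞) else 0 :=
    Measurable.ite hset measurable_const measurable_const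
  have hscale : ∀ t : ℝ, 0 < t → ∫⁻ v in D, F (x + t • v) =
      ENNReal.ofReal ((t ^ n)⁻¹) *
        ∫⁻ y, F y * (if t ≤ ‖y - x‖ ∧ ‖y - x‖ ≤ 2 * t then 1 else 0) := by
    intro t ht
    set G : Euc n → ℝ≥0∞ := fun y => F y * (if t ≤ ‖y - x‖ ∧ ‖y - x‖ ≤ 2 * t then 1 else 0)
      with hG
    have hGm : Measurable G := hF.mul (hite.comp measurable_prodMk_left)
    have h1 : ∫⁻ v in D, F (x + t • v) = ∫⁻ v, G (x + t • v) := by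
      rw [← lintegral_indicator hD]
      refine lintegral_congr fun v => ?_
      have hv : ‖x + t • v - x‖ = t * ‖v‖ := by
        rw [add_sub_cancel_left, norm_smul, Real.norm_of_nonneg ht.le]
      have hiff : (t ≤ t * ‖v‖ ∧ t * ‖v‖ ≤ 2 * t) ↔ v ∈ D := by
        rw [mul_comm 2 t, mul_le_mul_iff_right₀ ht, le_mul_iff_one_le_right ht]
        rfl
      simp only [hG, hv, hiff]
      by_cases hvD : v ∈ D <;> simp [hvD]
    have h2 : ∫⁻ v, G (x + t • v) =
        ∫⁻ w, G (x + w) ∂(Measure.map (t • ·) (volume : Measure (Euc n))) := by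
      rw [lintegral_map (by fun_prop) (by fun_prop)]
    rw [h1, h2, Measure.map_addHaar_smul _ ht.ne', lintegral_smul_measure,
      finrank_euclideanSpace_fin, abs_of_pos (by positivity), lintegral_add_left_eq_self]
    rfl
  calc ∫⁻ t in Ioi (0 : ℝ), ∫⁻ v in D, F (x + t • v)
      = ∫⁻ t in Ioi (0 : ℝ), ∫⁻ y, ENNReal.ofReal ((t ^ n)⁻¹) *
          (F y * (if t ≤ ‖y - x‖ ∧ ‖y - x‖ ≤ 2 * t then 1 else 0)) := by
        refine setLIntegral_congr_fun measurableSet_Ioi fun t ht => ?_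
        rw [hscale t ht, lintegral_const_mul]
        exact hF.mul (hite.comp measurable_prodMk_left)
    _ = ∫⁻ y, ∫⁻ t in Ioi (0 : ℝ), ENNReal.ofReal ((t ^ n)⁻¹) *
          (F y * (if t ≤ ‖y - x‖ ∧ ‖y - x‖ ≤ 2 * t then 1 else 0)) := by
        refine lintegral_lintegral_swap (Measurable.aemeasurable ?_)
        exact Measurable.mul (by fun_prop) ((hF.comp measurable_snd).mul hite)
    _ ≤ ∫⁻ y, 2 ^ (n - 1) * (F y * rieszKernel n x y) := by
        refine lintegral_mono fun y => ?_
        set ρ := ‖y - x‖ with hρ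
        rcases (norm_nonneg (y - x)).eq_or_lt with h0 | h0
        · have : ∫⁻ t in Ioi (0 : ℝ), ENNReal.ofReal ((t ^ n)⁻¹) *
              (F y * (if t ≤ ρ ∧ ρ ≤ 2 * t then 1 else 0)) = 0 := by
            rw [setLIntegral_eq_zero_iff measurableSet_Ioi]
            · refine Filter.Eventually.of_forall fun t ht => ?_
              have : ¬ t ≤ ρ := by rw [hρ, ← h0]; exact not_le.2 ht
              simp [this]
            · exact Measurable.mul (by fun_prop)
                (measurable_const.mul (hite.comp measurable_prodMk_right))
          rw [this]; exact zero_le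
        · rw [← hρ] at h0
          calc ∫⁻ t in Ioi (0 : ℝ), ENNReal.ofReal ((t ^ n)⁻¹) *
              (F y * (if t ≤ ρ ∧ ρ ≤ 2 * t then 1 else 0))
              ≤ ∫⁻ t in Ioi (0 : ℝ), (Icc (ρ / 2) ρ).indicator
                  (fun _ => ENNReal.ofReal (((ρ / 2) ^ n)⁻¹) * F y) t := by
                refine lintegral_mono fun t => ?_
                by_cases h : t ≤ ρ ∧ ρ ≤ 2 * t
                · rw [indicator_of_mem (show t ∈ Icc (ρ / 2) ρ from ⟨by linarith [h.2], h.1⟩),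
                    if_pos h, mul_one]
                  gcongr
                  linarith [h.2]
                · simp [h]
            _ ≤ ∫⁻ t, (Icc (ρ / 2) ρ).indicator
                  (fun _ => ENNReal.ofReal (((ρ / 2) ^ n)⁻¹) * F y) t :=
                setLIntegral_le_lintegral _ _
            _ = ENNReal.ofReal (((ρ / 2) ^ n)⁻¹) * F y * ENNReal.ofReal (ρ / 2) := by
                rw [lintegral_indicator_const measurableSet_Icc, Real.volume_Icc]
                congr 2; ring
            _ = 2 ^ (n - 1) * (F y * rieszKernel n x y) := by
                rw [rieszKernel, norm_sub_rev, ← hρ]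
                have e : ((ρ / 2) ^ n)⁻¹ * (ρ / 2) = 2 ^ (n - 1) * (ρ ^ (n - 1))⁻¹ := by
                  obtain ⟨d, rfl⟩ : ∃ d, n = d + 1 := ⟨n - 1, by omega⟩
                  simp only [Nat.add_sub_cancel]
                  rw [pow_succ, div_pow]
                  field_simp
                have e2 : (2 : ℝ≥0∞) ^ (n - 1) = ENNReal.ofReal (2 ^ (n - 1)) := by
                  rw [ENNReal.ofReal_pow (by norm_num)]; simp
                rw [mul_right_comm, ← ENNReal.ofReal_mul (by positivity), e,
                  ENNReal.ofReal_mul (by positivity), e2]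
                ring
    _ = _ := by rw [lintegral_const_mul _ (by fun_prop)]

/-- The directions `v` with `1 ≤ |v| ≤ 2` such that the ray from `x` along `v` meets `B`. -/
def rayCone {n : ℕ} (x : Euc n) (B : Set (Euc n)) : Set (Euc n) :=
  {v | (1 ≤ ‖v‖ ∧ ‖v‖ ≤ 2) ∧ ∃ t : ℝ, 0 < t ∧ x + t • v ∈ B}

/-- The constant in the comparison of cones of rays with the Hausdorff measure. -/
def coneConst (n : ℕ) : ℝ := 3 * 6 ^ n * ballVol n

lemma coneConst_pos (n : ℕ) : 0 < coneConst n := by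
  have := ballVol_pos n
  unfold coneConst
  positivity

lemma volume_rayCone_le_of_dist_le {n : ℕ} (hn : 2 ≤ n) (x : Euc n) (Q : Set (Euc n)) {R δ : ℝ}
    (hδ : 0 < δ) (hδR : δ ≤ R) (hR : ∀ q ∈ Q, R ≤ ‖q - x‖)
    (hQ : ∀ q ∈ Q, ∀ q' ∈ Q, ‖q - q'‖ ≤ δ) :
    volume (rayCone x Q) ≤ ENNReal.ofReal (coneConst n * (δ / R) ^ (n - 1)) := by
  have hR0 : 0 < R := hδ.trans_le hδR
  rcases Q.eq_empty_or_nonempty with rfl | ⟨q₀, hq₀⟩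
  · simp [rayCone]
  set b := q₀ - x with hb
  have hb0 : 0 < ‖b‖ := hR0.trans_le (hR q₀ hq₀)
  set e : Euc n := (‖b‖)⁻¹ • b with he
  have he1 : ‖e‖ = 1 := by
    rw [he, norm_smul, norm_inv, norm_norm, inv_mul_cancel₀ hb0.ne']
  set η := δ / R with hη
  have hη0 : 0 < η := div_pos hδ hR0
  have hη1 : η ≤ 1 := (div_le_one hR0).2 hδR
  set N := ⌊1 / η⌋₊ + 1 with hN
  have hcover : rayCone x Q ⊆ ⋃ i ∈ Finset.range N, Metric.ball ((1 + i * η) • e) (6 * η) := by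
    rintro v ⟨⟨hv1, hv2⟩, t, ht, hvQ⟩
    have hdist : ‖v - ‖v‖ • e‖ ≤ 4 * η := by
      set a := t • v with ha
      have ha' : a = (x + t • v) - x := by rw [add_sub_cancel_left]
      have haR : R ≤ ‖a‖ := by rw [ha']; exact hR _ hvQ
      have hab : ‖a - b‖ ≤ δ := by
        have : a - b = (x + t • v) - q₀ := by rw [hb, ha]; abel
        rw [this]; exact hQ _ hvQ _ hq₀
      have hat : ‖a‖ = t * ‖v‖ := by rw [ha, norm_smul, Real.norm_of_nonneg ht.le]
      have h1 : (t * ‖b‖) • (v - ‖v‖ • e) = ‖b‖ • (a - b) + (‖b‖ - ‖a‖) • b := by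
        have h0 : (t * ‖b‖) • (‖v‖ • e) = (t * ‖v‖) • b := by
          rw [he, smul_smul, smul_smul]
          congr 1
          field_simp
        rw [smul_sub, h0, hat, ha]
        module
      have h2 : t * ‖b‖ * ‖v - ‖v‖ • e‖ ≤ 2 * ‖b‖ * δ := by
        calc t * ‖b‖ * ‖v - ‖v‖ • e‖ = ‖(t * ‖b‖) • (v - ‖v‖ • e)‖ := by
              rw [norm_smul, Real.norm_of_nonneg (by positivity)]
          _ = ‖‖b‖ • (a - b) + (‖b‖ - ‖a‖) • b‖ := by rw [h1]
          _ ≤ ‖b‖ * ‖a - b‖ + |‖b‖ - ‖a‖| * ‖b‖ := by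
              refine (norm_add_le _ _).trans ?_
              rw [norm_smul, norm_smul, norm_norm, Real.norm_eq_abs]
          _ ≤ ‖b‖ * δ + δ * ‖b‖ := by
              have : |‖b‖ - ‖a‖| ≤ δ := by
                rw [abs_sub_comm]; exact (abs_norm_sub_norm_le a b).trans hab
              gcongr
          _ = 2 * ‖b‖ * δ := by ring
      have h3 : t * ‖v - ‖v‖ • e‖ ≤ 2 * δ := by
        have : ‖b‖ * (t * ‖v - ‖v‖ • e‖) ≤ ‖b‖ * (2 * δ) := by linarith
        exact le_of_mul_le_mul_left this hb0
      have h4 : R ≤ 2 * t := by nlinarith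
      have h5 : R * ‖v - ‖v‖ • e‖ ≤ R * (4 * η) := by
        have : R * (4 * η) = 4 * δ := by rw [hη]; field_simp
        rw [this]
        nlinarith [norm_nonneg (v - ‖v‖ • e)]
      exact le_of_mul_le_mul_left h5 hR0
    set i := ⌊(‖v‖ - 1) / η⌋₊ with hi
    have hi0 : 0 ≤ (‖v‖ - 1) / η := div_nonneg (by linarith) hη0.le
    have hi1 : (i : ℝ) * η ≤ ‖v‖ - 1 := by
      rw [← le_div_iff₀ hη0]; exact Nat.floor_le hi0
    have hi2 : ‖v‖ - 1 < (i + 1) * η := by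
      rw [← div_lt_iff₀ hη0]; exact Nat.lt_floor_add_one _
    refine mem_iUnion₂.2 ⟨i, ?_, ?_⟩
    · rw [Finset.mem_range, hN, Nat.lt_succ_iff]
      exact Nat.floor_le_floor (by gcongr; linarith)
    · rw [Metric.mem_ball, dist_eq_norm]
      have h6 : v - (1 + i * η) • e = (v - ‖v‖ • e) + (‖v‖ - (1 + i * η)) • e := by
        rw [sub_smul]; abel
      calc ‖v - (1 + i * η) • e‖ ≤ ‖v - ‖v‖ • e‖ + |‖v‖ - (1 + i * η)| := by
            rw [h6]
            refine (norm_add_le _ _).trans ?_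
            rw [norm_smul, he1, mul_one, Real.norm_eq_abs]
        _ ≤ 4 * η + η := by
            gcongr
            rw [abs_le]; constructor <;> linarith
        _ < 6 * η := by linarith
  calc volume (rayCone x Q)
      ≤ ∑ i ∈ Finset.range N, volume (Metric.ball ((1 + (i : ℝ) * η) • e) (6 * η)) :=
        (measure_mono hcover).trans (measure_biUnion_finset_le _ _)
    _ = ENNReal.ofReal (N * (ballVol n * (6 * η) ^ n)) := by
        simp_rw [volume_ball_eq _ (show 0 < 6 * η by positivity)]
        rw [Finset.sum_const, Finset.card_range, nsmul_eq_mul,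
          ENNReal.ofReal_mul (Nat.cast_nonneg N), ENNReal.ofReal_natCast]
    _ ≤ _ := by
        refine ENNReal.ofReal_le_ofReal ?_
        have hNη : (N : ℝ) * η ≤ 3 := by
          have h7 : (⌊1 / η⌋₊ : ℝ) ≤ 1 / η := Nat.floor_le (by positivity)
          have h8 : (⌊1 / η⌋₊ : ℝ) * η ≤ 1 := by rwa [← le_div_iff₀ hη0]
          rw [hN]; push_cast; linarith
        have hV := ballVol_pos n
        obtain ⟨d, rfl⟩ : ∃ d, n = d + 1 := ⟨n - 1, by omega⟩
        simp only [Nat.add_sub_cancel]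
        calc (N : ℝ) * (ballVol (d + 1) * (6 * η) ^ (d + 1))
            = (N * η) * (ballVol (d + 1) * 6 ^ (d + 1) * η ^ d) := by ring
          _ ≤ 3 * (ballVol (d + 1) * 6 ^ (d + 1) * η ^ d) := by gcongr
          _ = _ := by rw [coneConst]; ring

lemma volume_rayCone_le_ediam {n : ℕ} (hn : 2 ≤ n) (x : Euc n) (Q : Set (Euc n)) {R : ℝ}
    (hR0 : 0 < R) (hR : ∀ q ∈ Q, R ≤ ‖q - x‖) (hQ : Metric.ediam Q ≤ ENNReal.ofReal R) :
    volume (rayCone x Q) ≤ ENNReal.ofReal (coneConst n * (R ^ (n - 1))⁻¹) *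
      Metric.ediam Q ^ ((n : ℝ) - 1) := by
  have hfin : Metric.ediam Q ≠ ⊤ := ne_top_of_le_ne_top ENNReal.ofReal_ne_top hQ
  have hK := coneConst_pos n
  have hcast : ((n - 1 : ℕ) : ℝ) = (n : ℝ) - 1 := by rw [Nat.cast_sub (by omega)]; simp
  set δ := (Metric.ediam Q).toReal with hδ
  have hdist : ∀ q ∈ Q, ∀ q' ∈ Q, ‖q - q'‖ ≤ δ := by
    intro q hq q' hq'
    rw [← dist_eq_norm, dist_edist]
    exact ENNReal.toReal_mono hfin (Metric.edist_le_ediam_of_mem hq hq')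
  have hδR : δ ≤ R := ENNReal.toReal_le_of_le_ofReal hR0.le hQ
  rcases (ENNReal.toReal_nonneg : 0 ≤ δ).eq_or_lt with h0 | h0
  · have hlim : Filter.Tendsto (fun j : ℕ => ENNReal.ofReal (coneConst n * (1 / ((j : ℝ) + 1))))
        Filter.atTop (nhds 0) := by
      rw [← ENNReal.ofReal_zero]
      refine ENNReal.tendsto_ofReal ?_
      simpa using tendsto_one_div_add_atTop_nhds_zero_nat.const_mul (coneConst n)
    refine (ge_of_tendsto' hlim fun j => ?_).trans zero_le
    have hj : (0 : ℝ) < (j : ℝ) + 1 := by positivity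
    have hle1 : 1 / ((j : ℝ) + 1) ≤ 1 := by
      rw [div_le_one hj]; linarith [Nat.cast_nonneg (α := ℝ) j]
    refine (volume_rayCone_le_of_dist_le hn x Q (δ := R * (1 / ((j : ℝ) + 1))) (by positivity)
      (mul_le_of_le_one_right hR0.le hle1) hR fun q hq q' hq' => ?_).trans ?_
    · refine (hdist q hq q' hq').trans ?_
      have hδ0 : δ = 0 := h0.symm
      rw [hδ0]; positivity
    · refine ENNReal.ofReal_le_ofReal ?_
      rw [mul_div_cancel_left₀ _ hR0.ne']
      gcongr
      exact pow_le_of_le_one (by positivity) hle1 (by omega)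
  · refine (volume_rayCone_le_of_dist_le hn x Q h0 hδR hR hdist).trans (le_of_eq ?_)
    have hδ' : Metric.ediam Q = ENNReal.ofReal δ := (ENNReal.ofReal_toReal hfin).symm
    rw [hδ', ENNReal.ofReal_rpow_of_pos h0,
      ← ENNReal.ofReal_mul (by positivity), ← hcast, Real.rpow_natCast, div_pow]
    congr 1
    rw [mul_assoc, div_eq_inv_mul, ← hδ']

lemma volume_rayCone_le_hausdorffMeasure {n : ℕ} (hn : 2 ≤ n) (x : Euc n) (P : Set (Euc n))
    {R : ℝ} (hR0 : 0 < R) (hR : ∀ q ∈ P, R ≤ ‖q - x‖) :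
    volume (rayCone x P) ≤ ENNReal.ofReal (coneConst n * (R ^ (n - 1))⁻¹) *
      μH[(n : ℝ) - 1] P := by
  have hK := coneConst_pos n
  have hK' : 0 < coneConst n * (R ^ (n - 1))⁻¹ := by positivity
  refine ENNReal.le_of_forall_pos_le_add fun ε hε hlt => ?_
  set K := ENNReal.ofReal (coneConst n * (R ^ (n - 1))⁻¹) with hKdef
  have hK0 : K ≠ 0 := by rw [hKdef, Ne, ENNReal.ofReal_eq_zero]; linarith
  have hKt : K ≠ ⊤ := ENNReal.ofReal_ne_top
  have hPfin : μH[(n : ℝ) - 1] P ≠ ⊤ := fun h => by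
    rw [h, ENNReal.mul_top hK0] at hlt; exact lt_irrefl _ hlt
  have hεK : (ε : ℝ≥0∞) / K ≠ 0 := by
    rw [Ne, ENNReal.div_eq_zero_iff]; simp [hε.ne', hKt]
  have hlt' : (⨅ (t : ℕ → Set (Euc n)) (_ : P ⊆ ⋃ j, t j)
      (_ : ∀ j, Metric.ediam (t j) ≤ ENNReal.ofReal R),
      ∑' j, ⨆ _ : (t j).Nonempty, Metric.ediam (t j) ^ ((n : ℝ) - 1)) <
      μH[(n : ℝ) - 1] P + ε / K := by
    refine lt_of_le_of_lt ?_ (ENNReal.lt_add_right hPfin hεK)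
    rw [Measure.hausdorffMeasure_apply]
    exact le_iSup₂ (f := fun (r : ℝ≥0∞) (_ : 0 < r) =>
      ⨅ (t : ℕ → Set (Euc n)) (_ : P ⊆ ⋃ j, t j) (_ : ∀ j, Metric.ediam (t j) ≤ r),
      ∑' j, ⨆ _ : (t j).Nonempty, Metric.ediam (t j) ^ ((n : ℝ) - 1))
      (ENNReal.ofReal R) (ENNReal.ofReal_pos.2 hR0)
  simp only [iInf_lt_iff] at hlt'
  obtain ⟨t, hcov, hdiam, hsum⟩ := hlt'
  have hpiece : ∀ j, volume (rayCone x (P ∩ t j)) ≤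
      K * ⨆ _ : (t j).Nonempty, Metric.ediam (t j) ^ ((n : ℝ) - 1) := by
    intro j
    rcases (t j).eq_empty_or_nonempty with h | h
    · simp [h, rayCone]
    · rw [ciSup_pos h]
      have hsub : Metric.ediam (P ∩ t j) ≤ Metric.ediam (t j) :=
        Metric.ediam_mono inter_subset_right
      have hn1 : (0 : ℝ) ≤ (n : ℝ) - 1 := by
        have : (2 : ℝ) ≤ n := by exact_mod_cast hn
        linarith
      refine (volume_rayCone_le_ediam hn x (P ∩ t j) hR0 (fun q hq => hR q hq.1)
        (hsub.trans (hdiam j))).trans ?_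
      gcongr
  have hcone : rayCone x P ⊆ ⋃ j, rayCone x (P ∩ t j) := by
    rintro v ⟨hv, s, hs, hvP⟩
    obtain ⟨j, hj⟩ := mem_iUnion.1 (hcov hvP)
    exact mem_iUnion.2 ⟨j, hv, s, hs, hvP, hj⟩
  calc volume (rayCone x P) ≤ ∑' j, volume (rayCone x (P ∩ t j)) :=
        (measure_mono hcone).trans (measure_iUnion_le _)
    _ ≤ ∑' j, K * ⨆ _ : (t j).Nonempty, Metric.ediam (t j) ^ ((n : ℝ) - 1) :=
        ENNReal.tsum_le_tsum hpiece
    _ = K * ∑' j, ⨆ _ : (t j).Nonempty, Metric.ediam (t j) ^ ((n : ℝ) - 1) := ENNReal.tsum_mul_left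
    _ ≤ K * (μH[(n : ℝ) - 1] P + ε / K) := by gcongr
    _ = K * μH[(n : ℝ) - 1] P + ε := by rw [mul_add, ENNReal.mul_div_cancel hK0 hKt]

/-- The measure of the set of directions along which the rays from `x` meet `B` is controlled by
the Riesz potential of the `(n-1)`-dimensional Hausdorff measure on `B`. -/
lemma volume_rayCone_le_lintegral {n : ℕ} (hn : 2 ≤ n) (x : Euc n) (B : Set (Euc n))
    (hB : MeasurableSet B) (hx : x ∉ B) :
    volume (rayCone x B) ≤ ENNReal.ofReal (coneConst n * 2 ^ (n - 1)) *
      ∫⁻ y in B, rieszKernel n x y ∂μH[(n : ℝ) - 1] := by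
  have hK := coneConst_pos n
  set P : ℤ → Set (Euc n) := fun j => B ∩ {y | ‖y - x‖ ∈ Ico ((2 : ℝ) ^ j) (2 ^ (j + 1))} with hP
  have hPm : ∀ j, MeasurableSet (P j) := fun j =>
    hB.inter ((show Measurable fun y : Euc n => ‖y - x‖ by fun_prop) measurableSet_Ico)
  have hcone : rayCone x B ⊆ ⋃ j, rayCone x (P j) := by
    rintro v ⟨hv, s, hs, hvB⟩
    have hpos : 0 < ‖x + s • v - x‖ := by
      rw [norm_pos_iff, sub_ne_zero]
      rintro h
      exact hx (h ▸ hvB)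
    obtain ⟨j, hj⟩ := exists_mem_Ico_zpow hpos (one_lt_two : (1 : ℝ) < 2)
    exact mem_iUnion.2 ⟨j, hv, s, hs, hvB, hj⟩
  have hdisj : Pairwise (Function.onFun Disjoint P) := by
    intro i j hij
    have hI : Disjoint (Ico ((2 : ℝ) ^ i) (2 ^ (i + 1))) (Ico ((2 : ℝ) ^ j) (2 ^ (j + 1))) := by
      have := (zpow_right_mono₀ (one_le_two : (1 : ℝ) ≤ 2)).pairwise_disjoint_on_Ico_succ hij
      simpa [Function.onFun] using this
    exact Disjoint.mono inter_subset_right inter_subset_right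
      (Disjoint.preimage (fun y : Euc n => ‖y - x‖) hI)
  have hpiece : ∀ j, volume (rayCone x (P j)) ≤ ENNReal.ofReal (coneConst n * 2 ^ (n - 1)) *
      ∫⁻ y in P j, rieszKernel n x y ∂μH[(n : ℝ) - 1] := by
    intro j
    have h2j : (0 : ℝ) < 2 ^ j := by positivity
    refine (volume_rayCone_le_hausdorffMeasure hn x (P j) h2j fun q hq => hq.2.1).trans ?_
    have hlow : ENNReal.ofReal ((((2 : ℝ) ^ (j + 1)) ^ (n - 1))⁻¹) * μH[(n : ℝ) - 1] (P j) ≤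
        ∫⁻ y in P j, rieszKernel n x y ∂μH[(n : ℝ) - 1] := by
      rw [← setLIntegral_const]
      refine setLIntegral_mono' (hPm j) fun y hy => ?_
      have h1 : 0 < ‖x - y‖ := by rw [norm_sub_rev]; exact h2j.trans_le hy.2.1
      have h2 : ‖x - y‖ ≤ 2 ^ (j + 1) := by rw [norm_sub_rev]; exact hy.2.2.le
      unfold rieszKernel
      gcongr
    calc ENNReal.ofReal (coneConst n * (((2 : ℝ) ^ j) ^ (n - 1))⁻¹) * μH[(n : ℝ) - 1] (P j)
        = ENNReal.ofReal (coneConst n * 2 ^ (n - 1)) *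
          (ENNReal.ofReal ((((2 : ℝ) ^ (j + 1)) ^ (n - 1))⁻¹) * μH[(n : ℝ) - 1] (P j)) := by
          rw [← mul_assoc, ← ENNReal.ofReal_mul (by positivity)]
          congr 2
          rw [zpow_add_one₀ (two_ne_zero), mul_pow]
          field_simp
      _ ≤ _ := by gcongr
  calc volume (rayCone x B) ≤ ∑' j, volume (rayCone x (P j)) :=
        (measure_mono hcone).trans (measure_iUnion_le _)
    _ ≤ ∑' j, ENNReal.ofReal (coneConst n * 2 ^ (n - 1)) *
          ∫⁻ y in P j, rieszKernel n x y ∂μH[(n : ℝ) - 1] := ENNReal.tsum_le_tsum hpiece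
    _ = ENNReal.ofReal (coneConst n * 2 ^ (n - 1)) *
          ∫⁻ y in ⋃ j, P j, rieszKernel n x y ∂μH[(n : ℝ) - 1] := by
        rw [ENNReal.tsum_mul_left, lintegral_iUnion hPm hdisj]
    _ ≤ _ := by
        gcongr
        exact iUnion_subset fun j => inter_subset_left

/-- The constant in the comparison of the mollified Riesz kernel with the Riesz kernel. -/
def mollConst (n : ℕ) : ℝ :=
  2 ^ (n - 1) + (ballVol n * (1 / 2) ^ n)⁻¹ *
    ((1 + ballVol n * (n - 1)) * (ballVol n * 3 ^ n) ^ (1 / (n : ℝ))) * 2 ^ (n - 1)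

lemma mollConst_pos {n : ℕ} (hn : 2 ≤ n) : 0 < mollConst n := by
  have := ballVol_pos n
  have h2 : (2 : ℝ) ≤ n := by exact_mod_cast hn
  have h3 : (0 : ℝ) ≤ (n : ℝ) - 1 := by linarith
  unfold mollConst
  positivity

lemma lintegral_bump_rieszKernel_le {n : ℕ} (hn : 2 ≤ n) (φ : ContDiffBump (0 : Euc n))
    (hφ : φ.rOut = 2 * φ.rIn) {x z : Euc n} (hxz : x ≠ z) :
    ∫⁻ y, ENNReal.ofReal (φ.normed volume (y - z)) * rieszKernel n x y ≤
      ENNReal.ofReal (mollConst n) * rieszKernel n x z := by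
  have hV := ballVol_pos n
  have h2n : (2 : ℝ) ≤ n := by exact_mod_cast hn
  have h3n : (0 : ℝ) ≤ (n : ℝ) - 1 := by linarith
  have hr : 0 < φ.rOut := φ.rOut_pos
  have hd : 0 < ‖x - z‖ := norm_pos_iff.2 (sub_ne_zero.2 hxz)
  have hsupp : ∀ y, φ.normed volume (y - z) ≠ 0 → ‖y - z‖ < φ.rOut := by
    intro y hy
    have : y - z ∈ Function.support (φ.normed volume) := hy
    rw [φ.support_normed_eq] at this
    simpa using this
  rcases le_or_gt (2 * φ.rOut) ‖x - z‖ with hcase | hcase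
  · have hpt : ∀ y, ENNReal.ofReal (φ.normed volume (y - z)) * rieszKernel n x y ≤
        ENNReal.ofReal (φ.normed volume (y - z)) *
          (ENNReal.ofReal (2 ^ (n - 1)) * rieszKernel n x z) := by
      intro y
      by_cases hy : φ.normed volume (y - z) = 0
      · simp [hy]
      · refine mul_le_mul_right ?_ _
        have h1 := hsupp y hy
        have h2 : ‖x - z‖ / 2 ≤ ‖x - y‖ := by
          have := norm_sub_le_norm_sub_add_norm_sub x y z
          linarith
        unfold rieszKernel
        rw [← ENNReal.ofReal_mul (by positivity)]
        refine ENNReal.ofReal_le_ofReal ?_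
        calc (‖x - y‖ ^ (n - 1))⁻¹ ≤ ((‖x - z‖ / 2) ^ (n - 1))⁻¹ := by gcongr
          _ = _ := by rw [div_pow]; field_simp
    refine (lintegral_mono hpt).trans ?_
    have hne : ENNReal.ofReal (2 ^ (n - 1)) * rieszKernel n x z ≠ ⊤ :=
      ENNReal.mul_ne_top ENNReal.ofReal_ne_top ENNReal.ofReal_ne_top
    rw [lintegral_mul_const' _ _ hne]
    have h1 : ∫⁻ y, ENNReal.ofReal (φ.normed volume (y - z)) = 1 := by
      rw [lintegral_sub_right_eq_self (fun y => ENNReal.ofReal (φ.normed volume y)) z,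
        ← ofReal_integral_eq_lintegral_ofReal φ.integrable_normed
          (Filter.Eventually.of_forall φ.nonneg_normed), φ.integral_normed, ENNReal.ofReal_one]
    rw [h1, one_mul]
    gcongr
    unfold mollConst
    have : 0 ≤ (ballVol n * (1 / 2) ^ n)⁻¹ *
      ((1 + ballVol n * (n - 1)) * (ballVol n * 3 ^ n) ^ (1 / (n : ℝ))) * 2 ^ (n - 1) := by
      positivity
    linarith
  · set r := φ.rOut with hrdef
    have hrin : φ.rIn = r / 2 := by linarith
    have hA : ∀ y, φ.normed volume y ≤ (ballVol n * (r / 2) ^ n)⁻¹ := by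
      intro y
      refine (φ.normed_le_div_measure_closedBall_rIn volume y).trans (le_of_eq ?_)
      rw [Measure.real, Measure.addHaar_closedBall _ _ φ.rIn_pos.le, ENNReal.toReal_mul,
        ENNReal.toReal_ofReal (by positivity [φ.rIn_pos]), finrank_euclideanSpace_fin, hrin,
        ← ballVol, one_div, mul_comm]
    have hpt : ∀ y, ENNReal.ofReal (φ.normed volume (y - z)) * rieszKernel n x y ≤
        (Metric.ball x (3 * r)).indicator
          (fun y => ENNReal.ofReal ((ballVol n * (r / 2) ^ n)⁻¹) * rieszKernel n y x) y := by
      intro y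
      by_cases hy : φ.normed volume (y - z) = 0
      · simp [hy]
      · have h1 := hsupp y hy
        have h2 : y ∈ Metric.ball x (3 * r) := by
          rw [Metric.mem_ball, dist_eq_norm]
          have := norm_sub_le_norm_sub_add_norm_sub y z x
          rw [norm_sub_rev z x] at this
          linarith
        rw [indicator_of_mem h2, rieszKernel_comm]
        gcongr
        exact hA _
    refine (lintegral_mono hpt).trans ?_
    rw [lintegral_indicator Metric.isOpen_ball.measurableSet,
      lintegral_const_mul' _ _ ENNReal.ofReal_ne_top]
    have h1 := volume_lintegral_rieszKernel_le hn x (Metric.ball x (3 * r))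
    rw [volume_ball_eq x (by positivity), ENNReal.ofReal_rpow_of_pos (by positivity),
      ← ENNReal.ofReal_mul (by positivity)] at h1
    refine (mul_le_mul_right h1 _).trans ?_
    unfold rieszKernel
    rw [← ENNReal.ofReal_mul (by positivity), ← ENNReal.ofReal_mul (mollConst_pos hn).le]
    refine ENNReal.ofReal_le_ofReal ?_
    have h4 : (ballVol n * (3 * r) ^ n) ^ (1 / (n : ℝ)) =
        (ballVol n * 3 ^ n) ^ (1 / (n : ℝ)) * r := by
      rw [mul_pow, ← mul_assoc, Real.mul_rpow (by positivity) (by positivity), one_div,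
        Real.pow_rpow_inv_natCast hr.le (by omega)]
    have h5 : (ballVol n * (r / 2) ^ n)⁻¹ = (ballVol n * (1 / 2) ^ n)⁻¹ * (r ^ n)⁻¹ := by
      rw [← mul_inv]; congr 1; rw [div_pow, div_pow]; ring
    have h6 : (r ^ n)⁻¹ * r = (r ^ (n - 1))⁻¹ := by
      obtain ⟨d, rfl⟩ : ∃ d, n = d + 1 := ⟨n - 1, by omega⟩
      simp only [Nat.add_sub_cancel, pow_succ]
      field_simp
    have h7 : (r ^ (n - 1))⁻¹ ≤ 2 ^ (n - 1) * (‖x - z‖ ^ (n - 1))⁻¹ := by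
      calc (r ^ (n - 1))⁻¹ ≤ ((‖x - z‖ / 2) ^ (n - 1))⁻¹ := by
            gcongr
            linarith
        _ = _ := by rw [div_pow]; field_simp
    rw [h4, h5]
    calc (ballVol n * (1 / 2) ^ n)⁻¹ * (r ^ n)⁻¹ *
          ((1 + ballVol n * (n - 1)) * ((ballVol n * 3 ^ n) ^ (1 / (n : ℝ)) * r))
        = (ballVol n * (1 / 2) ^ n)⁻¹ *
          ((1 + ballVol n * (n - 1)) * (ballVol n * 3 ^ n) ^ (1 / (n : ℝ))) *
            ((r ^ n)⁻¹ * r) := by ring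
      _ ≤ (ballVol n * (1 / 2) ^ n)⁻¹ *
          ((1 + ballVol n * (n - 1)) * (ballVol n * 3 ^ n) ^ (1 / (n : ℝ))) *
            (2 ^ (n - 1) * (‖x - z‖ ^ (n - 1))⁻¹) := by rw [h6]; gcongr
      _ ≤ _ := by
        unfold mollConst
        rw [← mul_assoc]
        gcongr
        have : (0 : ℝ) ≤ 2 ^ (n - 1) := by positivity
        linarith

/-- Along a ray on whose exit points `u` is bounded by `k`, one reaches points of `Ω` at which
`u` is almost bounded by `k` without leaving `Ω`. -/
lemma exists_segment_subset_norm_le {n : ℕ} {Ω : Set (Euc n)} (hΩ : IsOpen Ω)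
    {u : Euc n → Euc n} (hu : MemCb n Ω u) {x v : Euc n} (hx : x ∈ Ω) (hv : v ≠ 0) {k δ : ℝ}
    (hk : 0 ≤ k) (hδ : 0 < δ) (h : ∀ t : ℝ, 0 < t → x + t • v ∈ frontier Ω → ‖u (x + t • v)‖ ≤ k) :
    ∃ τ : ℝ, 0 ≤ τ ∧ (∀ t ∈ Icc 0 τ, x + t • v ∈ Ω) ∧ ‖u (x + τ • v)‖ ≤ k + δ := by
  have hcont : Continuous fun t : ℝ => x + t • v := by fun_prop
  have hseg : ∀ τ : ℝ, (∀ t ∈ Icc 0 τ, x + t • v ∉ frontier Ω) → ∀ t ∈ Icc 0 τ, x + t • v ∈ Ω := by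
    intro τ hτ t ht
    by_contra hcon
    have hpre : IsPreconnected ((fun t : ℝ => x + t • v) '' Icc 0 τ) :=
      isPreconnected_Icc.image _ hcont.continuousOn
    have hno : ∀ s ∈ Icc 0 τ, x + s • v ∉ Ω → x + s • v ∉ closure Ω := fun s hs hs1 hs2 =>
      hτ s hs (by rw [hΩ.frontier_eq]; exact ⟨hs2, hs1⟩)
    obtain ⟨y, -, hy1, hy2⟩ := hpre Ω (closure Ω)ᶜ hΩ isClosed_closure.isOpen_compl
      (by
        rintro _ ⟨s, hs, rfl⟩
        by_cases hs1 : x + s • v ∈ Ω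
        · exact Or.inl hs1
        · exact Or.inr (hno s hs hs1))
      ⟨x, ⟨0, ⟨le_rfl, ht.1.trans ht.2⟩, by simp⟩, hx⟩ ⟨_, ⟨t, ht, rfl⟩, hno t ht hcon⟩
    exact hy2 (subset_closure hy1)
  have hxf : x ∉ frontier Ω := fun hc => by
    rw [hΩ.frontier_eq] at hc; exact hc.2 hx
  by_cases hhit : ∃ t : ℝ, 0 < t ∧ x + t • v ∈ frontier Ω
  · set T : Set ℝ := Ici 0 ∩ (fun t : ℝ => x + t • v) ⁻¹' frontier Ω with hT
    have hTc : IsClosed T := isClosed_Ici.inter (isClosed_frontier.preimage hcont)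
    have hTne : T.Nonempty := let ⟨t, ht, htf⟩ := hhit; ⟨t, ht.le, htf⟩
    have hTb : BddBelow T := ⟨0, fun t ht => ht.1⟩
    have hmem : sInf T ∈ T := hTc.csInf_mem hTne hTb
    set t₀ := sInf T with ht₀
    have ht₀pos : 0 < t₀ := by
      refine lt_of_le_of_ne hmem.1 fun h0 => hxf ?_
      have := hmem.2
      rw [← h0] at this
      simpa using this
    have hin : ∀ τ < t₀, ∀ t ∈ Icc 0 τ, x + t • v ∈ Ω := fun τ hτ =>
      hseg τ fun t ht hf => not_lt.2 (csInf_le hTb ⟨ht.1, hf⟩) (ht.2.trans_lt hτ)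
    have hk0 := h t₀ ht₀pos hmem.2
    have htend : Filter.Tendsto (fun t : ℝ => u (x + t • v)) (nhdsWithin t₀ (Ioo 0 t₀))
        (nhds (u (x + t₀ • v))) := by
      have h1 : ContinuousWithinAt u (closure Ω) (x + t₀ • v) :=
        hu.1 _ (frontier_subset_closure hmem.2)
      refine h1.tendsto.comp (tendsto_nhdsWithin_iff.2 ⟨?_, ?_⟩)
      · exact (hcont.tendsto t₀).mono_left nhdsWithin_le_nhds
      · filter_upwards [self_mem_nhdsWithin] with t ht
        exact subset_closure (hin t ht.2 t ⟨ht.1.le, le_rfl⟩)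
    have hev := htend.norm.eventually (gt_mem_nhds (show ‖u (x + t₀ • v)‖ < k + δ by linarith))
    have : (nhdsWithin t₀ (Ioo 0 t₀)).NeBot := by
      rw [← mem_closure_iff_nhdsWithin_neBot, closure_Ioo ht₀pos.ne]
      exact ⟨ht₀pos.le, le_rfl⟩
    obtain ⟨t, ht1, ht2⟩ := (hev.and self_mem_nhdsWithin).exists
    exact ⟨t, ht2.1.le, hin t ht2.2, ht1.le⟩
  · push Not at hhit
    have hall : ∀ τ : ℝ, ∀ t ∈ Icc 0 τ, x + t • v ∈ Ω := fun τ => hseg τ fun t ht => by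
      rcases ht.1.eq_or_lt with h0 | h0
      · rw [← h0]; simpa using hxf
      · exact hhit t h0
    obtain ⟨R, hR⟩ := hu.2.exists_norm_le
    have hv' : 0 < ‖v‖ := norm_pos_iff.2 hv
    set τ : ℝ := (|R| + ‖x‖ + 1) / ‖v‖ with hτ
    have hτ0 : 0 ≤ τ := by positivity
    refine ⟨τ, hτ0, hall τ, ?_⟩
    have hzero : u (x + τ • v) = 0 := by
      by_contra hne
      have h1 := hR _ ⟨subset_closure (hall τ τ ⟨hτ0, le_rfl⟩), hne⟩
      have h2 : ‖τ • v‖ = |R| + ‖x‖ + 1 := by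
        rw [norm_smul, Real.norm_of_nonneg hτ0, hτ, div_mul_cancel₀ _ hv'.ne']
      have h3 : ‖τ • v‖ ≤ ‖x + τ • v‖ + ‖x‖ := by
        have := norm_sub_le (x + τ • v) x
        simpa using this
      linarith [le_abs_self R]
    rw [hzero, norm_zero]
    linarith

lemma MemCb.exists_norm_le {n : ℕ} {Ω : Set (Euc n)} {u : Euc n → Euc n} (hu : MemCb n Ω u) :
    ∃ K : ℝ, ∀ x ∈ closure Ω, ‖u x‖ ≤ K := by
  obtain ⟨R, hR⟩ := hu.2.exists_norm_le
  have hcomp : IsCompact (closure Ω ∩ Metric.closedBall 0 R) :=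
    (isCompact_closedBall _ _).inter_left isClosed_closure
  obtain ⟨K, hK⟩ := hcomp.exists_bound_of_continuousOn (hu.1.mono inter_subset_left)
  refine ⟨max K 0, fun x hx => ?_⟩
  by_cases h0 : u x = 0
  · simp [h0]
  · exact (hK x ⟨hx, by simpa using hR x ⟨hx, h0⟩⟩).trans (le_max_left _ _)

lemma MemCb.integrableOn {n : ℕ} {Ω : Set (Euc n)} (hΩ : IsOpen Ω) {u : Euc n → Euc n}
    (hu : MemCb n Ω u) : IntegrableOn u Ω := by
  obtain ⟨R, hR⟩ := hu.2.exists_norm_le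
  obtain ⟨K, hK⟩ := hu.exists_norm_le
  have hmeas : AEStronglyMeasurable u (volume.restrict Ω) :=
    (hu.1.mono subset_closure).aestronglyMeasurable hΩ.measurableSet
  have h1 : IntegrableOn u (Ω ∩ Metric.closedBall 0 R) := by
    refine .of_bound ((measure_mono inter_subset_right).trans_lt measure_closedBall_lt_top)
      (hmeas.mono_measure (Measure.restrict_mono inter_subset_left le_rfl)) K ?_
    · filter_upwards [ae_restrict_mem (hΩ.measurableSet.inter measurableSet_closedBall)] with x hx
      exact hK x (subset_closure hx.1)
  refine h1.of_forall_sdiff_eq_zero hΩ.measurableSet fun x hx => ?_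
  by_contra hne
  exact hx.2 ⟨hx.1, by simpa using hR x ⟨subset_closure hx.1, hne⟩⟩

lemma abs_sum_mul_mul_le {n : ℕ} (v : Euc n) (M : EuclideanSpace ℝ (Fin n × Fin n)) :
    |∑ i, ∑ j, v i * v j * M (i, j)| ≤ ‖v‖ ^ 2 * ‖M‖ := by
  set V : EuclideanSpace ℝ (Fin n × Fin n) := WithLp.toLp 2 fun p => v p.1 * v p.2 with hV
  have h1 : ∑ i, ∑ j, v i * v j * M (i, j) = inner ℝ V M := by
    rw [PiLp.inner_apply, Fintype.sum_prod_type]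
    simp [hV, mul_comm]
  have h2 : ‖V‖ = ‖v‖ ^ 2 := by
    rw [← abs_of_nonneg (norm_nonneg V), ← abs_of_nonneg (sq_nonneg ‖v‖), ← sq_eq_sq_iff_abs_eq_abs,
      EuclideanSpace.real_norm_sq_eq, EuclideanSpace.real_norm_sq_eq, Fintype.sum_prod_type, sq,
      Finset.sum_mul_sum]
    simp [hV, mul_pow]
  rw [h1, ← h2]
  exact abs_real_inner_le_norm V M

/-- The weak formulation of the symmetric gradient in the direction `v`. -/
lemma IsSymmGradOn.integral_inner_mul_fderiv {n : ℕ} {Ω : Set (Euc n)} {u : Euc n → Euc n}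
    {E : Euc n → EuclideanSpace ℝ (Fin n × Fin n)} (hE : IsSymmGradOn n Ω u E)
    (hui : IntegrableOn u Ω) (v : Euc n) {φ : Euc n → ℝ} (hφ : ContDiff ℝ (⊤ : ℕ∞) φ)
    (hφc : HasCompactSupport φ) (hφΩ : tsupport φ ⊆ Ω) :
    ∫ z in Ω, inner ℝ (u z) v * fderiv ℝ φ z v =
      - ∫ z in Ω, (∑ i, ∑ j, v i * v j * E z (i, j)) * φ z := by
  have hfd : Continuous (fderiv ℝ φ) := hφ.continuous_fderiv (by simp)
  obtain ⟨K, hK⟩ := (hφc.fderiv ℝ).exists_bound_of_continuous hfd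
  have hint : ∀ i j : Fin n, IntegrableOn
      (fun z => u z i * fderiv ℝ φ z (EuclideanSpace.single j 1)) Ω := by
    intro i j
    have h1 : IntegrableOn (fun z => u z i) Ω :=
      (EuclideanSpace.proj (𝕜 := ℝ) i).integrable_comp hui
    refine h1.mul_bdd (c := K) (by fun_prop) (Filter.Eventually.of_forall fun z => ?_)
    refine ((fderiv ℝ φ z).le_opNorm _).trans ?_
    simpa using hK z
  have hintE : ∀ i j : Fin n, IntegrableOn (fun z => E z (i, j) * φ z) Ω := by
    intro i j
    have h1 : IntegrableOn E (tsupport φ) :=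
      hE.2.1.integrableOn_compact_subset hφΩ hφc
    have h2 : IntegrableOn (fun z => E z (i, j)) (tsupport φ) :=
      (EuclideanSpace.proj (𝕜 := ℝ) (i, j)).integrable_comp h1
    obtain ⟨K', hK'⟩ := hφc.exists_bound_of_continuous hφ.continuous
    have h3 : IntegrableOn (fun z => E z (i, j) * φ z) (tsupport φ) :=
      h2.mul_bdd (c := K') (hφ.continuous.aestronglyMeasurable) (Filter.Eventually.of_forall hK')
    refine (h3.integrable_of_forall_notMem_eq_zero fun z hz => ?_).integrableOn
    rw [image_eq_zero_of_notMem_tsupport hz, mul_zero]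
  have hv : ∀ z, fderiv ℝ φ z v = ∑ j, v j * fderiv ℝ φ z (EuclideanSpace.single j 1) := by
    intro z
    conv_lhs => rw [← (EuclideanSpace.basisFun (Fin n) ℝ).sum_repr v]
    simp
  have hinner : ∀ z, inner ℝ (u z) v = ∑ i, v i * u z i := by
    intro z
    simp [PiLp.inner_apply]
  have hL : ∀ z, inner ℝ (u z) v * fderiv ℝ φ z v =
      ∑ i, ∑ j, v i * v j * (u z i * fderiv ℝ φ z (EuclideanSpace.single j 1)) := by
    intro z
    rw [hv, hinner, Finset.sum_mul_sum]
    refine Finset.sum_congr rfl fun i _ => Finset.sum_congr rfl fun j _ => ?_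
    ring
  have hL' : ∀ z, inner ℝ (u z) v * fderiv ℝ φ z v =
      ∑ i, ∑ j, v i * v j * (u z j * fderiv ℝ φ z (EuclideanSpace.single i 1)) := by
    intro z
    rw [hL, Finset.sum_comm]
    refine Finset.sum_congr rfl fun i _ => Finset.sum_congr rfl fun j _ => ?_
    ring
  have hI : ∫ z in Ω, inner ℝ (u z) v * fderiv ℝ φ z v =
      ∑ i, ∑ j, v i * v j * ∫ z in Ω, u z i * fderiv ℝ φ z (EuclideanSpace.single j 1) := by
    simp_rw [hL]
    rw [integral_finsetSum _ fun i _ => integrable_finsetSum _ fun j _ => (hint i j).const_mul _]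
    refine Finset.sum_congr rfl fun i _ => ?_
    rw [integral_finsetSum _ fun j _ => (hint i j).const_mul _]
    exact Finset.sum_congr rfl fun j _ => integral_const_mul _ _
  have hI' : ∫ z in Ω, inner ℝ (u z) v * fderiv ℝ φ z v =
      ∑ i, ∑ j, v i * v j * ∫ z in Ω, u z j * fderiv ℝ φ z (EuclideanSpace.single i 1) := by
    simp_rw [hL']
    rw [integral_finsetSum _ fun i _ => integrable_finsetSum _ fun j _ => (hint j i).const_mul _]
    refine Finset.sum_congr rfl fun i _ => ?_
    rw [integral_finsetSum _ fun j _ => (hint j i).const_mul _]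
    exact Finset.sum_congr rfl fun j _ => integral_const_mul _ _
  have hR : ∫ z in Ω, (∑ i, ∑ j, v i * v j * E z (i, j)) * φ z =
      ∑ i, ∑ j, v i * v j * ∫ z in Ω, E z (i, j) * φ z := by
    simp_rw [Finset.sum_mul, mul_assoc]
    simp_rw [← mul_assoc (v _) (v _)]
    rw [integral_finsetSum _ fun i _ => integrable_finsetSum _ fun j _ => (hintE i j).const_mul _]
    refine Finset.sum_congr rfl fun i _ => ?_
    rw [integral_finsetSum _ fun j _ => (hintE i j).const_mul _]
    exact Finset.sum_congr rfl fun j _ => integral_const_mul _ _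
  have hsum : ∀ i j : Fin n,
      (∫ z in Ω, u z i * fderiv ℝ φ z (EuclideanSpace.single j 1)) +
        (∫ z in Ω, u z j * fderiv ℝ φ z (EuclideanSpace.single i 1)) =
      - (2 * ∫ z in Ω, E z (i, j) * φ z) := by
    intro i j
    rw [← integral_add (hint i j) (hint j i), hE.2.2 φ hφ hφc hφΩ i j, ← integral_const_mul]
    simp_rw [mul_assoc]
  have h2 : (∫ z in Ω, inner ℝ (u z) v * fderiv ℝ φ z v) +
      (∫ z in Ω, inner ℝ (u z) v * fderiv ℝ φ z v) =
      - (2 * ∫ z in Ω, (∑ i, ∑ j, v i * v j * E z (i, j)) * φ z) := by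
    nth_rewrite 1 [hI]
    rw [hI', hR, ← Finset.sum_add_distrib, Finset.mul_sum, ← Finset.sum_neg_distrib]
    refine Finset.sum_congr rfl fun i _ => ?_
    rw [← Finset.sum_add_distrib, Finset.mul_sum, ← Finset.sum_neg_distrib]
    refine Finset.sum_congr rfl fun j _ => ?_
    rw [← mul_add, hsum]
    ring
  linarith

/-- A standard family of bump functions shrinking to the origin. -/
def shrinkingBump (n m : ℕ) : ContDiffBump (0 : Euc n) where
  rIn := ((m : ℝ) + 1)⁻¹
  rOut := 2 * ((m : ℝ) + 1)⁻¹
  rIn_pos := by positivity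
  rIn_lt_rOut := by
    have : (0 : ℝ) < ((m : ℝ) + 1)⁻¹ := by positivity
    linarith

lemma tendsto_shrinkingBump_rOut (n : ℕ) :
    Filter.Tendsto (fun m => (shrinkingBump n m).rOut) Filter.atTop (nhds 0) := by
  have h : Filter.Tendsto (fun m : ℕ => 2 * (1 / ((m : ℝ) + 1))) Filter.atTop (nhds (2 * 0)) :=
    tendsto_one_div_add_atTop_nhds_zero_nat.const_mul 2
  simpa [shrinkingBump] using h

/-- The mollification of the `v`-component of `u`, extended by zero outside `Ω`. -/
def mollified {n : ℕ} (φ : ContDiffBump (0 : Euc n)) (Ω : Set (Euc n)) (u : Euc n → Euc n)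
    (v : Euc n) : Euc n → ℝ :=
  convolution (Ω.indicator fun z => inner ℝ (u z) v) (φ.normed volume)
    (ContinuousLinearMap.lsmul ℝ ℝ) volume

lemma integrable_indicator_inner {n : ℕ} {Ω : Set (Euc n)} (hΩ : IsOpen Ω) {u : Euc n → Euc n}
    (hui : IntegrableOn u Ω) (v : Euc n) :
    Integrable (Ω.indicator fun z => inner ℝ (u z) v) := by
  rw [integrable_indicator_iff hΩ.measurableSet]
  exact hui.inner_const v

lemma contDiff_mollified {n : ℕ} {Ω : Set (Euc n)} (hΩ : IsOpen Ω) {u : Euc n → Euc n}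
    (hui : IntegrableOn u Ω) (φ : ContDiffBump (0 : Euc n)) (v : Euc n) :
    ContDiff ℝ 1 (mollified φ Ω u v) := by
  exact_mod_cast φ.hasCompactSupport_normed.contDiff_convolution_right (n := 1) _
    (integrable_indicator_inner hΩ hui v).locallyIntegrable φ.contDiff_normed

lemma tendsto_mollified {n : ℕ} {Ω : Set (Euc n)} (hΩ : IsOpen Ω) {u : Euc n → Euc n}
    (hu : MemCb n Ω u) (v : Euc n) {x : Euc n} (hx : x ∈ Ω) :
    Filter.Tendsto (fun m => mollified (shrinkingBump n m) Ω u v x) Filter.atTop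
      (nhds (inner ℝ (u x) v)) := by
  have hint := integrable_indicator_inner hΩ (hu.integrableOn hΩ) v
  have h1 : ∀ m, mollified (shrinkingBump n m) Ω u v x =
      convolution ((shrinkingBump n m).normed volume) (Ω.indicator fun z => inner ℝ (u z) v)
        (ContinuousLinearMap.lsmul ℝ ℝ) volume x := by
    intro m
    rw [convolution_lsmul_swap]
    simp only [mollified, convolution, ContinuousLinearMap.lsmul_apply, smul_eq_mul, mul_comm]
  simp_rw [h1]
  refine ContDiffBump.convolution_tendsto_right (tendsto_shrinkingBump_rOut n)
    (Filter.Eventually.of_forall fun _ => hint.aestronglyMeasurable) ?_ tendsto_const_nhds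
  have h2 : ContinuousAt (Ω.indicator fun z => inner ℝ (u z) v) x := by
    have h3 : ContinuousAt (fun z => (inner ℝ (u z) v : ℝ)) x :=
      ((hu.1.mono subset_closure).continuousAt (hΩ.mem_nhds hx)).inner continuousAt_const
    refine h3.congr ?_
    filter_upwards [hΩ.mem_nhds hx] with z hz
    rw [indicator_of_mem hz]
  have h4 := h2.tendsto
  rw [indicator_of_mem hx] at h4
  exact h4.comp Filter.tendsto_snd

lemma enorm_fderiv_mollified_le {n : ℕ} {Ω : Set (Euc n)} (hΩ : IsOpen Ω) {u : Euc n → Euc n}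
    {E : Euc n → EuclideanSpace ℝ (Fin n × Fin n)} (hE : IsSymmGradOn n Ω u E)
    (hui : IntegrableOn u Ω) {e : Euc n → ℝ≥0∞} (he : ∀ᵐ z ∂volume.restrict Ω, ‖E z‖ₑ ≤ e z)
    (φ : ContDiffBump (0 : Euc n)) (v : Euc n) {y : Euc n}
    (hy : Metric.closedBall y φ.rOut ⊆ Ω) :
    ‖fderiv ℝ (mollified φ Ω u v) y v‖ₑ ≤
      ENNReal.ofReal (‖v‖ ^ 2) * ∫⁻ z in Ω, ENNReal.ofReal (φ.normed volume (y - z)) * e z := by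
  set ψ := φ.normed volume with hψ
  have hψs : ContDiff ℝ (⊤ : ℕ∞) ψ := φ.contDiff_normed
  have hψc : HasCompactSupport ψ := φ.hasCompactSupport_normed
  have hw := (integrable_indicator_inner hΩ hui v).locallyIntegrable
  have hder := hψc.hasFDerivAt_convolution_right (ContinuousLinearMap.lsmul ℝ ℝ) hw
    (hψs.of_le (by exact_mod_cast le_top)) y
  rw [mollified, hder.fderiv, convolution_precompR_apply _ hw (hψc.fderiv ℝ)
    (hψs.continuous_fderiv (by simp))]
  set θ : Euc n → ℝ := fun z => ψ (y - z) with hθ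
  have hθs : ContDiff ℝ (⊤ : ℕ∞) θ := hψs.comp (contDiff_const.sub contDiff_id)
  have hθc : HasCompactSupport θ := hψc.comp_homeomorph (Homeomorph.subLeft y)
  have hθΩ : tsupport θ ⊆ Ω := by
    refine Subset.trans (closure_minimal (fun z hz => ?_) Metric.isClosed_closedBall) hy
    have h1 : y - z ∈ tsupport ψ := subset_tsupport _ hz
    rw [hψ, φ.tsupport_normed_eq] at h1
    simpa [dist_eq_norm, norm_sub_rev] using h1
  have hθd : ∀ z, fderiv ℝ ψ (y - z) v = - fderiv ℝ θ z v := by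
    intro z
    have h1 : HasFDerivAt θ ((fderiv ℝ ψ (y - z)).comp (-ContinuousLinearMap.id ℝ (Euc n))) z :=
      ((hψs.differentiable (by simp)) (y - z)).hasFDerivAt.comp z
        ((hasFDerivAt_id z).const_sub y)
    rw [h1.fderiv]
    simp
  have hconv : convolution (Ω.indicator fun z => inner ℝ (u z) v) (fun a => fderiv ℝ ψ a v)
      (ContinuousLinearMap.lsmul ℝ ℝ) volume y =
      ∫ z in Ω, (∑ i, ∑ j, v i * v j * E z (i, j)) * θ z := by
    rw [← neg_neg (∫ z in Ω, (∑ i, ∑ j, v i * v j * E z (i, j)) * θ z),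
      ← hE.integral_inner_mul_fderiv hui v hθs hθc hθΩ, ← integral_neg, convolution,
      ← integral_indicator hΩ.measurableSet]
    congr 1
    funext z
    by_cases hz : z ∈ Ω
    · simp [hz, hθd]
    · simp [hz]
  rw [hconv]
  refine (enorm_integral_le_lintegral_enorm _).trans ?_
  rw [← lintegral_const_mul' _ _ ENNReal.ofReal_ne_top]
  refine lintegral_mono_ae ?_
  filter_upwards [he] with z hz
  have hθ0 : 0 ≤ θ z := φ.nonneg_normed _
  rw [enorm_mul, ← ofReal_norm (θ z), Real.norm_of_nonneg hθ0, mul_comm, mul_left_comm]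
  refine mul_le_mul_right ?_ _
  refine le_trans ?_ (mul_le_mul_right hz _)
  rw [← ofReal_norm, ← ofReal_norm, ← ENNReal.ofReal_mul (by positivity)]
  exact ENNReal.ofReal_le_ofReal (abs_sum_mul_mul_le v (E z))

lemma mollified_le_add_lintegral {n : ℕ} {Ω : Set (Euc n)} (hΩ : IsOpen Ω) {u : Euc n → Euc n}
    {E : Euc n → EuclideanSpace ℝ (Fin n × Fin n)} (hE : IsSymmGradOn n Ω u E)
    (hui : IntegrableOn u Ω) {e : Euc n → ℝ≥0∞} (he : ∀ᵐ z ∂volume.restrict Ω, ‖E z‖ₑ ≤ e z)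
    (φ : ContDiffBump (0 : Euc n)) (x v : Euc n) {τ : ℝ} (hτ : 0 ≤ τ)
    (hseg : ∀ t ∈ Icc 0 τ, Metric.closedBall (x + t • v) φ.rOut ⊆ Ω) :
    ENNReal.ofReal (mollified φ Ω u v x) ≤ ENNReal.ofReal (mollified φ Ω u v (x + τ • v)) +
      ENNReal.ofReal (‖v‖ ^ 2) * ∫⁻ t in Ioi (0 : ℝ), ∫⁻ z in Ω,
        ENNReal.ofReal (φ.normed volume (x + t • v - z)) * e z := by
  have hU := contDiff_mollified hΩ hui φ v
  set U := mollified φ Ω u v with hUdef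
  have hd : ∀ t : ℝ, HasDerivAt (fun t : ℝ => U (x + t • v)) (fderiv ℝ U (x + t • v) v) t := by
    intro t
    have h1 : HasDerivAt (fun t : ℝ => x + t • v) v t := by
      simpa using ((hasDerivAt_id t).smul_const v).const_add x
    exact ((hU.differentiable (by simp)) (x + t • v)).hasFDerivAt.comp_hasDerivAt t h1
  have hcont : Continuous fun t : ℝ => fderiv ℝ U (x + t • v) v := by
    have := hU.continuous_fderiv (by simp)
    fun_prop
  have hftc := intervalIntegral.integral_eq_sub_of_hasDerivAt (fun t _ => hd t)
    (hcont.intervalIntegrable 0 τ)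
  simp only [zero_smul, add_zero] at hftc
  have hle : U x ≤ U (x + τ • v) + ‖∫ t in (0 : ℝ)..τ, fderiv ℝ U (x + t • v) v‖ := by
    rw [hftc, Real.norm_eq_abs]
    have := neg_abs_le (U (x + τ • v) - U x)
    linarith
  refine (ENNReal.ofReal_le_ofReal hle).trans (ENNReal.ofReal_add_le.trans ?_)
  refine add_le_add le_rfl ?_
  rw [ofReal_norm, intervalIntegral.integral_of_le hτ]
  refine (enorm_integral_le_lintegral_enorm _).trans ?_
  rw [← lintegral_const_mul' _ _ ENNReal.ofReal_ne_top]
  refine (setLIntegral_mono' measurableSet_Ioc fun t ht =>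
    enorm_fderiv_mollified_le hΩ hE hui he φ v (hseg t ⟨ht.1.le, ht.2⟩)).trans ?_
  exact lintegral_mono_set Ioc_subset_Ioi_self

lemma inner_le_add_liminf {n : ℕ} {Ω : Set (Euc n)} (hΩ : IsOpen Ω) {u : Euc n → Euc n}
    {E : Euc n → EuclideanSpace ℝ (Fin n × Fin n)} (hE : IsSymmGradOn n Ω u E)
    (hu : MemCb n Ω u) {e : Euc n → ℝ≥0∞} (he : ∀ᵐ z ∂volume.restrict Ω, ‖E z‖ₑ ≤ e z)
    {x v : Euc n} (hx : x ∈ Ω) (hv1 : 1 ≤ ‖v‖) (hv2 : ‖v‖ ≤ 2) {k : ℝ} (hk : 0 ≤ k)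
    (h : ∀ t : ℝ, 0 < t → x + t • v ∈ frontier Ω → ‖u (x + t • v)‖ ≤ k) :
    ENNReal.ofReal (inner ℝ (u x) v) ≤ ENNReal.ofReal (2 * k) +
      Filter.liminf (fun m => 4 * ∫⁻ t in Ioi (0 : ℝ), ∫⁻ z in Ω,
        ENNReal.ofReal ((shrinkingBump n m).normed volume (x + t • v - z)) * e z)
        Filter.atTop := by
  refine ENNReal.le_of_forall_pos_le_add fun ε hε _ => ?_
  have hε' : (0 : ℝ) < ε := hε
  obtain ⟨τ, hτ, hseg, huτ⟩ := exists_segment_subset_norm_le hΩ hu hx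
    (norm_pos_iff.1 (one_pos.trans_le hv1)) hk (δ := ε / 4) (by positivity) h
  have hK : IsCompact ((fun t : ℝ => x + t • v) '' Icc 0 τ) :=
    isCompact_Icc.image (by fun_prop)
  obtain ⟨δ, hδ, hδΩ⟩ := hK.exists_cthickening_subset_open hΩ (by
    rintro _ ⟨t, ht, rfl⟩
    exact hseg t ht)
  have hball : ∀ t ∈ Icc 0 τ, Metric.closedBall (x + t • v) δ ⊆ Ω := fun t ht => by
    have hmem : x + t • v ∈ (fun t : ℝ => x + t • v) '' Icc 0 τ := ⟨t, ht, rfl⟩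
    exact (Metric.closedBall_subset_cthickening hmem δ).trans hδΩ
  have hxτ : x + τ • v ∈ Ω := hseg τ ⟨hτ, le_rfl⟩
  have hend : inner ℝ (u (x + τ • v)) v ≤ 2 * k + ε / 2 := by
    refine (real_inner_le_norm _ _).trans ?_
    calc ‖u (x + τ • v)‖ * ‖v‖ ≤ (k + ε / 4) * 2 := by gcongr
      _ = _ := by ring
  have hev : ∀ᶠ m in Filter.atTop, ENNReal.ofReal (inner ℝ (u x) v) -
      ENNReal.ofReal (2 * k + ε) ≤ 4 * ∫⁻ t in Ioi (0 : ℝ), ∫⁻ z in Ω,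
        ENNReal.ofReal ((shrinkingBump n m).normed volume (x + t • v - z)) * e z := by
    filter_upwards [(tendsto_shrinkingBump_rOut n).eventually (gt_mem_nhds hδ),
      (tendsto_mollified hΩ hu v hx).eventually (lt_mem_nhds
        (show inner ℝ (u x) v - ε / 4 < inner ℝ (u x) v by linarith)),
      (tendsto_mollified hΩ hu v hxτ).eventually (gt_mem_nhds
        (show inner ℝ (u (x + τ • v)) v < inner ℝ (u (x + τ • v)) v + ε / 4 by linarith))]
      with m hm1 hm2 hm3
    have h1 := mollified_le_add_lintegral hΩ hE (hu.integrableOn hΩ) he (shrinkingBump n m) x v hτ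
      fun t ht => (Metric.closedBall_subset_closedBall hm1.le).trans (hball t ht)
    have h4 : ENNReal.ofReal (‖v‖ ^ 2) ≤ 4 := by
      rw [show (4 : ℝ≥0∞) = ENNReal.ofReal (2 ^ 2) by norm_num]
      gcongr
    rw [tsub_le_iff_left]
    calc ENNReal.ofReal (inner ℝ (u x) v)
        ≤ ENNReal.ofReal (mollified (shrinkingBump n m) Ω u v x + ε / 4) := by gcongr; linarith
      _ ≤ ENNReal.ofReal (mollified (shrinkingBump n m) Ω u v x) + ENNReal.ofReal (ε / 4) :=
        ENNReal.ofReal_add_le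
      _ ≤ ENNReal.ofReal (2 * k + ε * (3 / 4)) + 4 * (∫⁻ t in Ioi (0 : ℝ), ∫⁻ z in Ω,
            ENNReal.ofReal ((shrinkingBump n m).normed volume (x + t • v - z)) * e z) +
            ENNReal.ofReal (ε / 4) := by
        refine add_le_add (h1.trans (add_le_add (ENNReal.ofReal_le_ofReal ?_) ?_)) le_rfl
        · linarith
        · exact mul_le_mul_left h4 _
      _ = _ := by
        rw [add_right_comm, ← ENNReal.ofReal_add (by positivity) (by positivity)]
        congr 2
        ring_nf
  have h5 := Filter.le_liminf_of_le (h := hev)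
  rw [tsub_le_iff_left] at h5
  refine h5.trans (le_of_eq ?_)
  rw [ENNReal.ofReal_add (by positivity) (by positivity), ENNReal.ofReal_coe_nnreal]
  ring

lemma measurable_lintegral_bump {n : ℕ} (Ω : Set (Euc n)) {e : Euc n → ℝ≥0∞} (he : Measurable e)
    (φ : ContDiffBump (0 : Euc n)) :
    Measurable fun y => ∫⁻ z in Ω, ENNReal.ofReal (φ.normed volume (y - z)) * e z := by
  refine Measurable.lintegral_prod_right'
    (f := fun p : Euc n × Euc n => ENNReal.ofReal (φ.normed volume (p.1 - p.2)) * e p.2) ?_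
  have := φ.continuous_normed (μ := volume)
  exact ((this.comp (continuous_fst.sub continuous_snd)).measurable.ennreal_ofReal).mul
    (he.comp measurable_snd)

lemma lintegral_lintegral_bump_mul_rieszKernel_le {n : ℕ} (hn : 2 ≤ n) (Ω : Set (Euc n))
    {e : Euc n → ℝ≥0∞} (he : Measurable e) (φ : ContDiffBump (0 : Euc n))
    (hφ : φ.rOut = 2 * φ.rIn) (x : Euc n) :
    ∫⁻ y, (∫⁻ z in Ω, ENNReal.ofReal (φ.normed volume (y - z)) * e z) * rieszKernel n x y ≤
      ENNReal.ofReal (mollConst n) * ∫⁻ z in Ω, e z * rieszKernel n x z := by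
  have hc := φ.continuous_normed (μ := volume)
  have hm : Measurable fun p : Euc n × Euc n => ENNReal.ofReal (φ.normed volume (p.1 - p.2)) :=
    (hc.comp (continuous_fst.sub continuous_snd)).measurable.ennreal_ofReal
  have hκ := measurable_rieszKernel_right (n := n) x
  calc ∫⁻ y, (∫⁻ z in Ω, ENNReal.ofReal (φ.normed volume (y - z)) * e z) * rieszKernel n x y
      = ∫⁻ y, ∫⁻ z in Ω, ENNReal.ofReal (φ.normed volume (y - z)) * e z * rieszKernel n x y := by
        refine lintegral_congr fun y => ?_
        have hne : rieszKernel n x y ≠ ⊤ := ENNReal.ofReal_ne_top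
        rw [lintegral_mul_const' _ _ hne]
    _ = ∫⁻ z in Ω, ∫⁻ y, ENNReal.ofReal (φ.normed volume (y - z)) * e z * rieszKernel n x y :=
        lintegral_lintegral_swap ((hm.mul (he.comp measurable_snd)).mul
          (hκ.comp measurable_fst)).aemeasurable
    _ = ∫⁻ z in Ω, e z * ∫⁻ y, ENNReal.ofReal (φ.normed volume (y - z)) * rieszKernel n x y := by
        refine lintegral_congr fun z => ?_
        have hmz : Measurable fun y =>
            ENNReal.ofReal (φ.normed volume (y - z)) * rieszKernel n x y :=
          (hm.comp (measurable_id.prodMk measurable_const)).mul hκ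
        rw [← lintegral_const_mul _ hmz]
        refine lintegral_congr fun y => ?_
        rw [mul_comm _ (e z), mul_assoc]
    _ ≤ ∫⁻ z in Ω, ENNReal.ofReal (mollConst n) * (e z * rieszKernel n x z) := by
        have : Nontrivial (Euc n) := Module.nontrivial_of_finrank_pos (R := ℝ) (by
          rw [finrank_euclideanSpace_fin]; omega)
        refine lintegral_mono_ae (ae_restrict_of_ae ?_)
        filter_upwards [compl_mem_ae_iff.2 (measure_singleton (μ := volume) x)] with z hz
        rw [mul_left_comm]
        exact mul_le_mul_right (lintegral_bump_rieszKernel_le hn φ hφ fun h => hz h.symm) _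
    _ = _ := lintegral_const_mul' _ _ ENNReal.ofReal_ne_top

/-- Half the measure of the ball of directions used in the pointwise estimate. -/
def dirVol (n : ℕ) : ℝ := ballVol n * (1 / 4) ^ n / 2

lemma dirVol_pos (n : ℕ) : 0 < dirVol n := by
  have := ballVol_pos n
  unfold dirVol
  positivity

/-- The pointwise estimate of `u` by its values on the boundary and the Riesz potential of its
symmetric gradient. -/
lemma ofReal_norm_le_add_rieszPotential {n : ℕ} (hn : 2 ≤ n) {Ω : Set (Euc n)} (hΩ : IsOpen Ω)
    {u : Euc n → Euc n} {E : Euc n → EuclideanSpace ℝ (Fin n × Fin n)}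
    (hE : IsSymmGradOn n Ω u E) (hu : MemCb n Ω u) {e : Euc n → ℝ≥0∞} (hem : Measurable e)
    (he : ∀ᵐ z ∂volume.restrict Ω, ‖E z‖ₑ ≤ e z) {x : Euc n} (hx : x ∈ Ω) {k : ℝ} (hk : 0 ≤ k)
    (hcone : volume (rayCone x (frontier Ω ∩ {y | k < ‖u y‖})) ≤ ENNReal.ofReal (dirVol n)) :
    ENNReal.ofReal ‖u x‖ ≤ ENNReal.ofReal (2 * k) +
      ENNReal.ofReal (4 * 2 ^ (n - 1) * mollConst n / dirVol n) *
        ∫⁻ z in Ω, e z * rieszKernel n x z := by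
  have hc := dirVol_pos n
  have hmc := mollConst_pos hn
  by_cases hux : u x = 0
  · simp [hux]
  have hN : 0 < ‖u x‖ := norm_pos_iff.2 hux
  set a : Euc n := (3 / 2 / ‖u x‖) • u x with ha
  have han : ‖a‖ = 3 / 2 := by
    rw [ha, norm_smul, Real.norm_of_nonneg (by positivity), div_mul_cancel₀ _ hN.ne']
  have hai : inner ℝ (u x) a = 3 / 2 * ‖u x‖ := by
    rw [ha, real_inner_smul_right, real_inner_self_eq_norm_sq]
    field_simp
  set D := Metric.ball a (1 / 4) with hD
  have hDn : ∀ v ∈ D, 1 ≤ ‖v‖ ∧ ‖v‖ ≤ 2 := by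
    intro v hv
    rw [hD, Metric.mem_ball, dist_eq_norm] at hv
    have h1 := norm_sub_norm_le v a
    have h2 := norm_sub_norm_le a v
    rw [norm_sub_rev] at h2
    constructor <;> linarith
  have hDi : ∀ v ∈ D, ‖u x‖ ≤ inner ℝ (u x) v := by
    intro v hv
    rw [hD, Metric.mem_ball, dist_eq_norm] at hv
    have h1 : inner ℝ (u x) v = inner ℝ (u x) a + inner ℝ (u x) (v - a) := by
      rw [← inner_add_right]; simp
    have h2 := neg_le_of_abs_le (abs_real_inner_le_norm (u x) (v - a))
    have h3 : ‖u x‖ * ‖v - a‖ ≤ ‖u x‖ * (1 / 4) := by gcongr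
    rw [h1, hai]
    linarith
  set M := toMeasurable volume (rayCone x (frontier Ω ∩ {y | k < ‖u y‖})) with hM
  set S := D \ M with hS
  set G : ℕ → Euc n → ℝ≥0∞ := fun m v => 4 * ∫⁻ t in Ioi (0 : ℝ), ∫⁻ z in Ω,
    ENNReal.ofReal ((shrinkingBump n m).normed volume (x + t • v - z)) * e z with hG
  set I := ∫⁻ z in Ω, e z * rieszKernel n x z with hI
  have hpt : ∀ v ∈ S, ENNReal.ofReal ‖u x‖ ≤
      ENNReal.ofReal (2 * k) + Filter.liminf (fun m => G m v) Filter.atTop := by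
    intro v hv
    refine (ENNReal.ofReal_le_ofReal (hDi v hv.1)).trans ?_
    refine inner_le_add_liminf hΩ hE hu he hx (hDn v hv.1).1 (hDn v hv.1).2 hk fun t ht htf => ?_
    by_contra hlt
    exact hv.2 (subset_toMeasurable _ _ ⟨hDn v hv.1, t, ht, htf, not_le.1 hlt⟩)
  have hSm : MeasurableSet S :=
    Metric.isOpen_ball.measurableSet.diff (measurableSet_toMeasurable _ _)
  have hvolD : volume D = ENNReal.ofReal (2 * dirVol n) := by
    rw [hD, volume_ball_eq _ (by norm_num), dirVol]
    congr 1
    ring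
  have hvolS : ENNReal.ofReal (dirVol n) ≤ volume S := by
    calc ENNReal.ofReal (dirVol n)
        = ENNReal.ofReal (2 * dirVol n) - ENNReal.ofReal (dirVol n) := by
          rw [← ENNReal.ofReal_sub _ hc.le]; congr 1; ring
      _ ≤ volume D - volume M := by
          rw [hvolD, hM, measure_toMeasurable]; gcongr
      _ ≤ volume S := le_measure_sdiff
  have hS0 : volume S ≠ 0 := ((ENNReal.ofReal_pos.2 hc).trans_le hvolS).ne'
  have hSt : volume S ≠ ⊤ :=
    ne_top_of_le_ne_top measure_ball_lt_top.ne (measure_mono sdiff_subset)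
  have hF : ∀ m, Measurable fun y => ∫⁻ z in Ω,
      ENNReal.ofReal ((shrinkingBump n m).normed volume (y - z)) * e z := fun m =>
    measurable_lintegral_bump Ω hem _
  have hGm : ∀ m, Measurable (G m) := by
    intro m
    refine Measurable.const_mul ?_ _
    refine Measurable.lintegral_prod_right' (f := fun p : Euc n × ℝ => ∫⁻ z in Ω,
      ENNReal.ofReal ((shrinkingBump n m).normed volume (x + p.2 • p.1 - z)) * e z) ?_
    exact (hF m).comp (by fun_prop : Measurable fun p : Euc n × ℝ => x + p.2 • p.1)
  have hGint : ∀ m, ∫⁻ v in {v | 1 ≤ ‖v‖ ∧ ‖v‖ ≤ 2}, G m v ≤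
      ENNReal.ofReal (4 * 2 ^ (n - 1) * mollConst n) * I := by
    intro m
    rw [hG, lintegral_const_mul' _ _ (by norm_num)]
    calc 4 * ∫⁻ v in {v : Euc n | 1 ≤ ‖v‖ ∧ ‖v‖ ≤ 2}, ∫⁻ t in Ioi (0 : ℝ), ∫⁻ z in Ω,
          ENNReal.ofReal ((shrinkingBump n m).normed volume (x + t • v - z)) * e z
        ≤ 4 * (2 ^ (n - 1) * (ENNReal.ofReal (mollConst n) * I)) := by
          refine mul_le_mul_right ((lintegral_directions_le hn x _ (hF m)).trans ?_) _
          exact mul_le_mul_right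
            (lintegral_lintegral_bump_mul_rieszKernel_le hn Ω hem _ rfl x) _
      _ = _ := by
          rw [ENNReal.ofReal_mul (by positivity), ENNReal.ofReal_mul (by positivity),
            ENNReal.ofReal_pow (by positivity), ENNReal.ofReal_ofNat, ENNReal.ofReal_ofNat]
          ring
  have hint : ENNReal.ofReal ‖u x‖ * volume S ≤ ENNReal.ofReal (2 * k) * volume S +
      ENNReal.ofReal (4 * 2 ^ (n - 1) * mollConst n) * I := by
    calc ENNReal.ofReal ‖u x‖ * volume S = ∫⁻ _ in S, ENNReal.ofReal ‖u x‖ := by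
          rw [setLIntegral_const]
      _ ≤ ∫⁻ v in S, (ENNReal.ofReal (2 * k) + Filter.liminf (fun m => G m v) Filter.atTop) :=
          setLIntegral_mono' hSm hpt
      _ = ENNReal.ofReal (2 * k) * volume S +
          ∫⁻ v in S, Filter.liminf (fun m => G m v) Filter.atTop := by
          rw [lintegral_add_left measurable_const, setLIntegral_const]
      _ ≤ _ := by
          refine add_le_add le_rfl ?_
          calc ∫⁻ v in S, Filter.liminf (fun m => G m v) Filter.atTop
              ≤ ∫⁻ v in {v | 1 ≤ ‖v‖ ∧ ‖v‖ ≤ 2}, Filter.liminf (fun m => G m v) Filter.atTop :=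
                lintegral_mono_set fun v hv => hDn v hv.1
            _ ≤ Filter.liminf (fun m => ∫⁻ v in {v | 1 ≤ ‖v‖ ∧ ‖v‖ ≤ 2}, G m v) Filter.atTop :=
                lintegral_liminf_le hGm
            _ ≤ Filter.liminf (fun _ : ℕ => ENNReal.ofReal (4 * 2 ^ (n - 1) * mollConst n) * I)
                Filter.atTop := Filter.liminf_le_liminf (Filter.Eventually.of_forall hGint)
            _ = _ := Filter.liminf_const _
  calc ENNReal.ofReal ‖u x‖ = ENNReal.ofReal ‖u x‖ * volume S / volume S :=
        (ENNReal.mul_div_cancel_right hS0 hSt).symm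
    _ ≤ (ENNReal.ofReal (2 * k) * volume S +
          ENNReal.ofReal (4 * 2 ^ (n - 1) * mollConst n) * I) / volume S := by gcongr
    _ = ENNReal.ofReal (2 * k) +
          ENNReal.ofReal (4 * 2 ^ (n - 1) * mollConst n) * I / volume S := by
        rw [ENNReal.add_div, ENNReal.mul_div_cancel_right hS0 hSt]
    _ ≤ ENNReal.ofReal (2 * k) +
          ENNReal.ofReal (4 * 2 ^ (n - 1) * mollConst n) * I / ENNReal.ofReal (dirVol n) := by
        gcongr
    _ = _ := by
        rw [ENNReal.ofReal_div_of_pos hc, div_eq_mul_inv, div_eq_mul_inv, mul_right_comm]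

/-- The weighted average `s^{-a} ∫_0^{s^b} φ`. -/
def hardyAverage (a b : ℝ) (φ : ℝ → ℝ≥0∞) (s : ℝ) : ℝ≥0∞ :=
  ENNReal.ofReal (s ^ (-a)) * ∫⁻ r in Ioc (0 : ℝ) (s ^ b), φ r

/-- The weighted tail integral `∫_{s^b}^∞ r^{-a} φ(r) dr`. -/
def hardyTail (a b : ℝ) (φ : ℝ → ℝ≥0∞) (s : ℝ) : ℝ≥0∞ :=
  ∫⁻ r in Ioi (s ^ b), ENNReal.ofReal (r ^ (-a)) * φ r

lemma AhlforsUpper.measure_ball_le {n : ℕ} {Ω : Set (Euc n)} {μ : Measure (Euc n)} {α Cμ : ℝ}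
    (hμ : AhlforsUpper n Ω μ α Cμ) (hμΩ : μ Ωᶜ = 0) (y : Euc n) {r : ℝ} (hr : 0 < r) :
    μ (Metric.ball y r) ≤ ENNReal.ofReal (Cμ * 2 ^ α * r ^ α) := by
  have h1 : μ (Metric.ball y r) = μ (Metric.ball y r ∩ Ω) :=
    (measure_inter_conull hμΩ).symm
  rw [h1]
  rcases (Metric.ball y r ∩ Ω).eq_empty_or_nonempty with h | ⟨x, hxy, hx⟩
  · simp [h]
  · refine (measure_mono (inter_subset_inter_left _ ?_)).trans
      ((hμ x hx (2 * r) (by positivity)).trans (le_of_eq ?_))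
    · refine Metric.ball_subset_ball' ?_
      rw [dist_comm]
      linarith [Metric.mem_ball.1 hxy]
    · rw [Real.mul_rpow (by norm_num) hr.le, mul_assoc]

lemma ofReal_mul_le_lintegral_Ioc {φ : ℝ → ℝ≥0∞} {σ : ℝ} (hφ : ∀ s ≤ σ, φ σ ≤ φ s) :
    ENNReal.ofReal σ * φ σ ≤ ∫⁻ r in Ioc 0 σ, φ r := by
  calc ENNReal.ofReal σ * φ σ = ∫⁻ _ in Ioc 0 σ, φ σ := by
        rw [setLIntegral_const, Real.volume_Ioc, sub_zero, mul_comm]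
    _ ≤ _ := setLIntegral_mono' measurableSet_Ioc fun r hr => hφ r hr.2

/-- A lower bound for the average of a non-increasing function. -/
lemma ofReal_rpow_mul_le_hardyAverage {φ : ℝ → ℝ≥0∞} (hφ : ∀ s t, s ≤ t → φ t ≤ φ s) (a b : ℝ)
    {s : ℝ} (hs : 0 < s) :
    ENNReal.ofReal (s ^ (b - a)) * φ (s ^ b) ≤ hardyAverage a b φ s := by
  have h1 : s ^ (b - a) = s ^ (-a) * s ^ b := by
    rw [← Real.rpow_add hs]
    congr 1
    ring
  rw [h1, ENNReal.ofReal_mul (by positivity), mul_assoc, hardyAverage]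
  exact mul_le_mul_right (ofReal_mul_le_lintegral_Ioc fun r hr => hφ r _ hr) _

/-- Weak-type estimate for the potential of a boundary set of small measure. -/
lemma measure_boundary_rieszPotential_gt_le {n : ℕ} (hn : 2 ≤ n) {α A : ℝ}
    (hα : (n : ℝ) - 1 < α) (hA : 0 ≤ A) (μ : Measure (Euc n))
    (hμ : ∀ y : Euc n, ∀ r : ℝ, 0 < r → μ (Metric.ball y r) ≤ ENNReal.ofReal (A * r ^ α))
    {m : Measure (Euc n)} {s l : ℝ} (hs : 0 < s) (hl : 0 < l)
    (hm : m univ ≤ ENNReal.ofReal (s ^ (((n : ℝ) - 1) / α))) :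
    μ {x | ENNReal.ofReal l < ∫⁻ y, rieszKernel n x y ∂m} ≤
      ENNReal.ofReal (((1 + A / (α / ((n : ℝ) - 1) - 1)) / l) ^ (α / ((n : ℝ) - 1)) * s) := by
  have h2 : (2 : ℝ) ≤ n := by exact_mod_cast hn
  have hn1 : (0 : ℝ) < (n : ℝ) - 1 := by linarith
  have hα0 : 0 < α := hn1.trans hα
  set p := α / ((n : ℝ) - 1) with hp
  have hp1 : 1 < p := by rwa [hp, one_lt_div hn1]
  have hp0 : 0 < p - 1 := by linarith
  set W := 1 + A / (p - 1) with hW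
  have hW0 : 0 < W := by positivity
  have : IsFiniteMeasure m := ⟨hm.trans_lt ENNReal.ofReal_lt_top⟩
  have hsp : (s ^ (((n : ℝ) - 1) / α)) ^ p = s := by
    rw [← Real.rpow_mul hs.le, hp]
    field_simp
    exact Real.rpow_one s
  refine (measure_rieszPotential_gt_le hn hp1 hA μ (fun y r hr => ?_) m
    (c := ENNReal.ofReal (W / l * s ^ (((n : ℝ) - 1) / α))) ENNReal.ofReal_ne_top ?_).trans ?_
  · rw [hp, div_mul_cancel₀ _ hn1.ne']
    exact hμ y r hr
  · rw [← ENNReal.ofReal_mul hl.le, ← mul_assoc, mul_div_cancel₀ _ hl.ne',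
      ENNReal.ofReal_mul hW0.le]
    exact mul_le_mul_right hm _
  · rw [ENNReal.ofReal_rpow_of_pos (by positivity), Real.mul_rpow (by positivity) (by positivity),
      hsp]

/-- The Riesz potential of a function is controlled by Hardy-type terms of its rearrangement
outside a small set. -/
lemma measure_rieszPotential_gt_hardy_le {n : ℕ} (hn : 2 ≤ n) {α A : ℝ}
    (hα : (n : ℝ) - 1 < α) (hA : 0 ≤ A) (μ : Measure (Euc n))
    (hμ : ∀ y : Euc n, ∀ r : ℝ, 0 < r → μ (Metric.ball y r) ≤ ENNReal.ofReal (A * r ^ α))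
    (Ω : Set (Euc n)) {f : Euc n → ℝ} (hf : ∀ x, 0 ≤ f x) (hfm : Measurable f)
    {s : ℝ} (hs : 0 < s) :
    μ {x | ENNReal.ofReal (1 + A / (α / ((n : ℝ) - 1) - 1) + (1 + ballVol n * (n - 1))) *
        (hardyAverage (((n : ℝ) - 1) / α) (n / α) (rearr (volume.restrict Ω) f) s +
          hardyTail (((n : ℝ) - 1) / n) (n / α) (rearr (volume.restrict Ω) f) s) <
        ∫⁻ z in Ω, ENNReal.ofReal (f z) * rieszKernel n x z} ≤ ENNReal.ofReal s := by
  have h2 : (2 : ℝ) ≤ n := by exact_mod_cast hn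
  have hn0 : (0 : ℝ) < n := by linarith
  have hn1 : (0 : ℝ) < (n : ℝ) - 1 := by linarith
  have hα0 : 0 < α := hn1.trans hα
  set p := α / ((n : ℝ) - 1) with hp
  have hp1 : 1 < p := by rwa [hp, one_lt_div hn1]
  have hp0 : 0 < p - 1 := by linarith
  set W := 1 + A / (p - 1) with hW
  have hW0 : 0 < W := by positivity
  set W₂ := 1 + ballVol n * ((n : ℝ) - 1) with hW₂
  have hW₂0 : 0 < W₂ := by have := ballVol_pos n; positivity
  set ν := volume.restrict Ω with hν
  set T₁ := hardyAverage (((n : ℝ) - 1) / α) (n / α) (rearr ν f) s with hT₁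
  set T₂ := hardyTail (((n : ℝ) - 1) / n) (n / α) (rearr ν f) s with hT₂
  set σ := s ^ ((n : ℝ) / α) with hσ
  have hσ0 : 0 < σ := by positivity
  by_cases hT₁t : T₁ = ⊤
  · have : ENNReal.ofReal (W + W₂) ≠ 0 := (ENNReal.ofReal_pos.2 (by positivity)).ne'
    simp [hT₁t, ENNReal.mul_top this]
  have hw0 : ENNReal.ofReal (s ^ (-(((n : ℝ) - 1) / α))) ≠ 0 :=
    (ENNReal.ofReal_pos.2 (by positivity)).ne'
  set I := ∫⁻ r in Ioc (0 : ℝ) σ, rearr ν f r with hI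
  have hT₁I : T₁ = ENNReal.ofReal (s ^ (-(((n : ℝ) - 1) / α))) * I := rfl
  have hIt : I ≠ ⊤ := fun h => hT₁t (by rw [hT₁I, h, ENNReal.mul_top hw0])
  have hlow : ENNReal.ofReal (s ^ (1 / α)) * rearr ν f σ ≤ T₁ := by
    have := ofReal_rpow_mul_le_hardyAverage (φ := rearr ν f) (fun _ _ h => rearr_antitone ν f h)
      (((n : ℝ) - 1) / α) (n / α) hs
    rwa [show (n : ℝ) / α - (n - 1) / α = 1 / α by ring] at this
  have hkt : rearr ν f σ ≠ ⊤ := fun h => hT₁t (by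
    rw [h, ENNReal.mul_top (ENNReal.ofReal_pos.2 (by positivity)).ne'] at hlow
    exact top_le_iff.1 hlow)
  set k := (rearr ν f σ).toReal with hk
  have hk0 : 0 ≤ k := ENNReal.toReal_nonneg
  have hkk : ENNReal.ofReal k = rearr ν f σ := ENNReal.ofReal_toReal hkt
  have hlev : ν {x | k < f x} ≤ ENNReal.ofReal σ := by
    refine le_trans (measure_mono fun x hx => ?_) (measure_rearr_lt_le ν f σ)
    have hx' : k < f x := hx
    change rearr ν f σ < ENNReal.ofReal |f x|
    rw [← hkk, abs_of_nonneg (hf x)]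
    exact (ENNReal.ofReal_lt_ofReal_iff_of_nonneg hk0).2 hx'
  have hsub := lintegral_sub_level_le ν f hf hfm hk0 hlev
  have hg₁ : Measurable fun z => ENNReal.ofReal (f z - k) := (hfm.sub_const k).ennreal_ofReal
  have hg₂ : Measurable fun z => ENNReal.ofReal (min (f z) k) :=
    (hfm.min measurable_const).ennreal_ofReal
  set m := ν.withDensity fun z => ENNReal.ofReal (f z - k) with hm
  have hmu : m univ ≤ I := by
    rw [hm, withDensity_apply _ MeasurableSet.univ, Measure.restrict_univ]
    exact hsub
  have : IsFiniteMeasure m := ⟨hmu.trans_lt hIt.lt_top⟩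
  have hsp : (s ^ (((n : ℝ) - 1) / α)) ^ p = s := by
    rw [← Real.rpow_mul hs.le, hp]
    field_simp
    exact Real.rpow_one s
  have hweak : μ {x | ENNReal.ofReal W * T₁ < ∫⁻ y, rieszKernel n x y ∂m} ≤ ENNReal.ofReal s := by
    refine (measure_rieszPotential_gt_le hn hp1 hA μ (fun y r hr => ?_) m
      (c := ENNReal.ofReal (s ^ (((n : ℝ) - 1) / α)))
      (ENNReal.mul_ne_top ENNReal.ofReal_ne_top hT₁t) ?_).trans ?_
    · rw [hp, div_mul_cancel₀ _ hn1.ne']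
      exact hμ y r hr
    · rw [mul_assoc, hT₁I, mul_right_comm, ← ENNReal.ofReal_mul (by positivity),
        ← Real.rpow_add hs, neg_add_cancel, Real.rpow_zero, ENNReal.ofReal_one, one_mul]
      exact mul_le_mul_right hmu _
    · rw [ENNReal.ofReal_rpow_of_pos (by positivity), hsp]
  refine (measure_mono fun x hx => ?_).trans hweak
  have hx' : ENNReal.ofReal (W + W₂) * (T₁ + T₂) <
    ∫⁻ z, ENNReal.ofReal (f z) * rieszKernel n x z ∂ν := hx
  change ENNReal.ofReal W * T₁ < ∫⁻ y, rieszKernel n x y ∂m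
  by_contra! hcon
  refine absurd hx' (not_lt.2 ?_)
  have hκ := measurable_rieszKernel_right (n := n) x
  have hsplit : ∀ z, ENNReal.ofReal (f z) * rieszKernel n x z ≤
      ENNReal.ofReal (f z - k) * rieszKernel n x z +
        ENNReal.ofReal (min (f z) k) * rieszKernel n x z := by
    intro z
    rw [← add_mul]
    refine mul_le_mul_left ?_ _
    rcases le_total (f z) k with h | h
    · rw [min_eq_left h]; exact le_add_self
    · rw [min_eq_right h, ← ENNReal.ofReal_add (sub_nonneg.2 h) hk0, sub_add_cancel]
  have hsecond : ∫⁻ z, ENNReal.ofReal (min (f z) k) * rieszKernel n x z ∂ν ≤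
      ENNReal.ofReal W₂ * (T₁ + T₂) := by
    have h1 := lintegral_min_level_le ν (ν.withDensity (rieszKernel n x)) f hf hfm
      (q := 1 / (n : ℝ)) (by positivity) hσ0 hk0 (A := ENNReal.ofReal W₂) (fun F hF => by
        rw [withDensity_apply _ hF, hν, Measure.restrict_restrict hF, Measure.restrict_apply hF]
        simp_rw [rieszKernel_comm x]
        exact volume_lintegral_rieszKernel_le hn x (F ∩ Ω))
    rw [lintegral_withDensity_eq_lintegral_mul _ hκ hg₂] at h1
    simp only [Pi.mul_apply, mul_comm (rieszKernel n x _)] at h1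
    refine h1.trans (mul_le_mul_right (add_le_add ?_ ?_) _)
    · have hσn : σ ^ (1 / (n : ℝ)) = s ^ (1 / α) := by
        rw [hσ, ← Real.rpow_mul hs.le]
        congr 1
        field_simp
      rw [hσn, ENNReal.ofReal_mul (by positivity), hkk]
      exact hlow
    · have hq : (1 : ℝ) / n - 1 = -(((n : ℝ) - 1) / n) := by field_simp; ring
      rw [hq]
      refine mul_le_of_le_one_left' ?_
      rw [ENNReal.ofReal_le_one, div_le_one hn0]
      linarith
  have hfirst : ∫⁻ z, ENNReal.ofReal (f z - k) * rieszKernel n x z ∂ν ≤ ENNReal.ofReal W * T₁ := by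
    rw [hm, lintegral_withDensity_eq_lintegral_mul _ hg₁ hκ] at hcon
    exact hcon
  calc ∫⁻ z, ENNReal.ofReal (f z) * rieszKernel n x z ∂ν
      ≤ ∫⁻ z, (ENNReal.ofReal (f z - k) * rieszKernel n x z +
          ENNReal.ofReal (min (f z) k) * rieszKernel n x z) ∂ν := lintegral_mono hsplit
    _ = ∫⁻ z, ENNReal.ofReal (f z - k) * rieszKernel n x z ∂ν +
          ∫⁻ z, ENNReal.ofReal (min (f z) k) * rieszKernel n x z ∂ν :=
        lintegral_add_left (hg₁.mul hκ) _
    _ ≤ ENNReal.ofReal W * (T₁ + T₂) + ENNReal.ofReal W₂ * (T₁ + T₂) :=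
        add_le_add (hfirst.trans (mul_le_mul_right le_self_add _)) hsecond
    _ = _ := by rw [ENNReal.ofReal_add hW0.le hW₂0.le, add_mul]

lemma MemCb.measurableSet_frontier_inter {n : ℕ} {Ω : Set (Euc n)} {u : Euc n → Euc n}
    (hu : MemCb n Ω u) (k : ℝ) : MeasurableSet (frontier Ω ∩ {y | k < ‖u y‖}) := by
  have h1 : IsClosed (frontier Ω ∩ (fun y => ‖u y‖) ⁻¹' Iic k) :=
    ((hu.1.mono frontier_subset_closure).norm).preimage_isClosed_of_isClosed
      isClosed_frontier isClosed_Iic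
  have h2 : frontier Ω ∩ {y | k < ‖u y‖} =
      frontier Ω \ (frontier Ω ∩ (fun y => ‖u y‖) ⁻¹' Iic k) := by
    ext y
    simp
  rw [h2]
  exact isClosed_frontier.measurableSet.diff h1.measurableSet

/-- The rearrangement estimate behind the reduction principle. -/
lemma exists_rearr_le_hardy {n : ℕ} (hn : 2 ≤ n) {α Cμ : ℝ} (hα : (n : ℝ) - 1 < α)
    (hCμ : 0 < Cμ) :
    ∃ c K : ℝ, 0 < c ∧ 0 < K ∧ ∀ (Ω : Set (Euc n)), IsOpen Ω →
      ∀ μ : Measure (Euc n), μ Ωᶜ = 0 → AhlforsUpper n Ω μ α Cμ →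
      ∀ (u : Euc n → Euc n) (E : Euc n → EuclideanSpace ℝ (Fin n × Fin n)),
        IsSymmGradOn n Ω u E → MemCb n Ω u → ∀ s : ℝ, 0 < s →
        rearr μ (fun x => ‖u x‖) (c * s) ≤ ENNReal.ofReal K *
          (hardyAverage (((n : ℝ) - 1) / α) (n / α)
              (rearr (volume.restrict Ω) fun x => ‖E x‖) s +
            hardyTail (((n : ℝ) - 1) / n) (n / α)
              (rearr (volume.restrict Ω) fun x => ‖E x‖) s +
            hardyAverage (((n : ℝ) - 1) / α) (((n : ℝ) - 1) / α)
              (rearr (μH[(n : ℝ) - 1].restrict (frontier Ω)) fun x => ‖u x‖) s) := by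
  have h2 : (2 : ℝ) ≤ n := by exact_mod_cast hn
  have hn1 : (0 : ℝ) < (n : ℝ) - 1 := by linarith
  have hα0 : 0 < α := hn1.trans hα
  set A := Cμ * 2 ^ α with hA
  have hA0 : 0 < A := by positivity
  have hp1 : 0 < α / ((n : ℝ) - 1) - 1 := by
    rw [sub_pos, one_lt_div hn1]; exact hα
  have hcone := coneConst_pos n
  have hdir := dirVol_pos n
  have hmoll := mollConst_pos hn
  have hball := ballVol_pos n
  set W := 1 + A / (α / ((n : ℝ) - 1) - 1) with hW
  have hW0 : 0 < W := by positivity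
  set W₂ := 1 + ballVol n * ((n : ℝ) - 1) with hW₂
  have hW₂0 : 0 < W₂ := by positivity
  set l := dirVol n / (coneConst n * 2 ^ (n - 1)) with hl
  have hl0 : 0 < l := by positivity
  set P := 4 * 2 ^ (n - 1) * mollConst n / dirVol n with hP
  have hP0 : 0 < P := by positivity
  set a := (W / l) ^ (α / ((n : ℝ) - 1)) with ha
  have ha0 : 0 < a := by positivity
  refine ⟨a + 1, 2 + P * (W + W₂), by positivity, by positivity, ?_⟩
  intro Ω hΩ μ hμΩ hμ u E hE hu s hs
  have hgrowth : ∀ y : Euc n, ∀ r : ℝ, 0 < r → μ (Metric.ball y r) ≤ ENNReal.ofReal (A * r ^ α) :=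
    fun y r hr => hμ.measure_ball_le hμΩ y hr
  have hEm : AEStronglyMeasurable E (volume.restrict Ω) := hE.2.1.aestronglyMeasurable
  set f : Euc n → ℝ := fun z => ‖hEm.mk E z‖ with hf
  have hfm : Measurable f := hEm.stronglyMeasurable_mk.norm.measurable
  have hEf : (fun x => ‖E x‖) =ᵐ[volume.restrict Ω] f := by
    filter_upwards [hEm.ae_eq_mk] with x hx
    simp only [hf, hx]
  have hrE : rearr (volume.restrict Ω) (fun x => ‖E x‖) = rearr (volume.restrict Ω) f :=
    funext fun r => rearr_congr_ae _ hEf r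
  rw [hrE]
  set ν := μH[(n : ℝ) - 1].restrict (frontier Ω) with hν
  set T₁ := hardyAverage (((n : ℝ) - 1) / α) (n / α) (rearr (volume.restrict Ω) f) s with hT₁
  set T₂ := hardyTail (((n : ℝ) - 1) / n) (n / α) (rearr (volume.restrict Ω) f) s with hT₂
  set T₃ := hardyAverage (((n : ℝ) - 1) / α) (((n : ℝ) - 1) / α) (rearr ν fun x => ‖u x‖) s
    with hT₃
  set σ := s ^ (((n : ℝ) - 1) / α) with hσ
  have hkT : rearr ν (fun x => ‖u x‖) σ ≤ T₃ := by
    have := ofReal_rpow_mul_le_hardyAverage (φ := rearr ν fun x => ‖u x‖)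
      (fun _ _ h => rearr_antitone ν _ h) (((n : ℝ) - 1) / α) (((n : ℝ) - 1) / α) hs
    rwa [sub_self, Real.rpow_zero, ENNReal.ofReal_one, one_mul] at this
  by_cases hT₃t : T₃ = ⊤
  · have : ENNReal.ofReal (2 + P * (W + W₂)) ≠ 0 := (ENNReal.ofReal_pos.2 (by positivity)).ne'
    simp [hT₃t, ENNReal.mul_top this]
  have hkt : rearr ν (fun x => ‖u x‖) σ ≠ ⊤ := ne_top_of_le_ne_top hT₃t hkT
  set k := (rearr ν (fun x => ‖u x‖) σ).toReal with hk
  have hk0 : 0 ≤ k := ENNReal.toReal_nonneg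
  have hkk : ENNReal.ofReal k = rearr ν (fun x => ‖u x‖) σ := ENNReal.ofReal_toReal hkt
  set B := frontier Ω ∩ {y | k < ‖u y‖} with hB
  have hBm : MeasurableSet B := hu.measurableSet_frontier_inter k
  have hBσ : (μH[(n : ℝ) - 1].restrict B) univ ≤ ENNReal.ofReal σ := by
    rw [Measure.restrict_apply_univ]
    refine le_trans ?_ (measure_rearr_lt_le ν (fun x => ‖u x‖) σ)
    rw [hν, Measure.restrict_apply' isClosed_frontier.measurableSet]
    refine measure_mono fun y hy => ⟨?_, hy.1⟩
    have hy2 : k < ‖u y‖ := hy.2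
    change rearr ν (fun x => ‖u x‖) σ < ENNReal.ofReal |‖u y‖|
    rw [← hkk, abs_norm]
    exact (ENNReal.ofReal_lt_ofReal_iff_of_nonneg hk0).2 hy2
  have hex₁ := measure_boundary_rieszPotential_gt_le hn hα hA0.le μ hgrowth hs hl0 hBσ
  have hex₂ := measure_rieszPotential_gt_hardy_le hn hα hA0.le μ hgrowth Ω
    (f := f) (fun _ => norm_nonneg _) hfm hs
  refine rearr_le _ _ ?_
  rw [show (a + 1) * s = 0 + a * s + s by ring, ENNReal.ofReal_add (by positivity) hs.le,
    ENNReal.ofReal_add le_rfl (by positivity), ENNReal.ofReal_zero]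
  refine le_trans ?_ (add_le_add (add_le_add hμΩ.le hex₁) hex₂)
  refine le_trans (measure_mono ?_)
    ((measure_union_le _ _).trans (add_le_add (measure_union_le _ _) le_rfl))
  intro x hx
  by_contra hxn
  simp only [mem_union, not_or, mem_compl_iff, not_not] at hxn
  obtain ⟨⟨hxΩ, hx₁⟩, hx₂⟩ := hxn
  have hx₁' : ∫⁻ y in B, rieszKernel n x y ∂μH[(n : ℝ) - 1] ≤ ENNReal.ofReal l := not_lt.1 hx₁
  have hx₂' : ∫⁻ z in Ω, ENNReal.ofReal (f z) * rieszKernel n x z ≤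
      ENNReal.ofReal (W + W₂) * (T₁ + T₂) := not_lt.1 hx₂
  have hxB : x ∉ B := fun h => by
    have := h.1
    rw [hΩ.frontier_eq] at this
    exact this.2 hxΩ
  have hcn : volume (rayCone x B) ≤ ENNReal.ofReal (dirVol n) := by
    refine (volume_rayCone_le_lintegral hn x B hBm hxB).trans ((mul_le_mul_right hx₁' _).trans ?_)
    rw [← ENNReal.ofReal_mul (by positivity), hl, mul_div_cancel₀ _ (by positivity)]
  have hpt := ofReal_norm_le_add_rieszPotential hn hΩ hE hu (e := fun z => ENNReal.ofReal (f z))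
    hfm.ennreal_ofReal (by
      filter_upwards [hEm.ae_eq_mk] with z hz
      rw [hz, ← ofReal_norm]) hxΩ hk0 hcn
  have hx' : ENNReal.ofReal (2 + P * (W + W₂)) * (T₁ + T₂ + T₃) < ENNReal.ofReal |‖u x‖| := hx
  rw [abs_norm] at hx'
  refine absurd hx' (not_lt.2 (hpt.trans ?_))
  calc ENNReal.ofReal (2 * k) + ENNReal.ofReal P *
        ∫⁻ z in Ω, ENNReal.ofReal (f z) * rieszKernel n x z
      ≤ ENNReal.ofReal 2 * T₃ + ENNReal.ofReal P * (ENNReal.ofReal (W + W₂) * (T₁ + T₂)) := by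
        refine add_le_add ?_ (mul_le_mul_right hx₂' _)
        rw [ENNReal.ofReal_mul (by norm_num), hkk]
        exact mul_le_mul_right hkT _
    _ ≤ ENNReal.ofReal 2 * (T₁ + T₂ + T₃) +
          ENNReal.ofReal P * (ENNReal.ofReal (W + W₂) * (T₁ + T₂ + T₃)) := by
        exact add_le_add (mul_le_mul_right le_add_self _)
          (mul_le_mul_right (mul_le_mul_right le_self_add _) _)
    _ = _ := by
        rw [ENNReal.ofReal_add (p := 2) (q := P * (W + W₂)) (by norm_num) (by positivity),
          ENNReal.ofReal_mul (p := P) (q := W + W₂) hP0.le, add_mul, mul_assoc]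

/-- **Theorem (Reduction principle).** If the representation norms of the
rearrangement-invariant spaces `X`, `Y`, `Z` satisfy the three one-dimensional Hardy-type
inequalities (with constant `C`) on non-increasing functions, then there is
`C' = C'(n, α, Cμ, C)` such that `‖u‖_{Y(Ω,μ)} ≤ C' (‖Eu‖_{X(Ω)} + ‖u‖_{Z(∂Ω)})` for every
`u ∈ E¹X(Ω) ∩ C_b(Ω̄)`; here the norm of a function in each space is the representation
norm of its decreasing rearrangement. -/
theorem reduction_principle (n : ℕ) (hn : 2 ≤ n) (α Cμ C : ℝ)
    (hα1 : (n : ℝ) - 1 < α) (hα2 : α ≤ n) (hCμ : 0 < Cμ) (hC : 0 < C) :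
    ∃ C' : ℝ, 0 < C' ∧
      ∀ (Ω : Set (Euc n)), IsOpen Ω →
      ∀ μ : Measure (Euc n), μ Ωᶜ = 0 → AhlforsUpper n Ω μ α Cμ →
      ∀ X Y Z : RINorm,
        (∀ φ : ℝ → ℝ≥0∞, (∀ s t : ℝ, 0 ≤ s → s ≤ t → φ t ≤ φ s) →
          Y.N (fun s => ENNReal.ofReal (s ^ (-(((n : ℝ) - 1) / α))) *
              ∫⁻ r in Set.Ioc (0 : ℝ) (s ^ ((n : ℝ) / α)), φ r) ≤
            ENNReal.ofReal C * X.N φ) →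
        (∀ φ : ℝ → ℝ≥0∞, (∀ s t : ℝ, 0 ≤ s → s ≤ t → φ t ≤ φ s) →
          Y.N (fun s => ∫⁻ r in Set.Ioi (s ^ ((n : ℝ) / α)),
              ENNReal.ofReal (r ^ (-(((n : ℝ) - 1) / (n : ℝ)))) * φ r) ≤
            ENNReal.ofReal C * X.N φ) →
        (∀ φ : ℝ → ℝ≥0∞, (∀ s t : ℝ, 0 ≤ s → s ≤ t → φ t ≤ φ s) →
          Y.N (fun s => ENNReal.ofReal (s ^ (-(((n : ℝ) - 1) / α))) *
              ∫⁻ r in Set.Ioc (0 : ℝ) (s ^ (((n : ℝ) - 1) / α)), φ r) ≤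
            ENNReal.ofReal C * Z.N φ) →
        ∀ (u : Euc n → Euc n) (E : Euc n → EuclideanSpace ℝ (Fin n × Fin n)),
          IsSymmGradOn n Ω u E →
          MemCb n Ω u →
          X.N (rearr (volume.restrict Ω) (fun x => ‖E x‖)) ≠ ⊤ →
          Y.N (rearr μ (fun x => ‖u x‖)) ≤
            ENNReal.ofReal C' *
              (X.N (rearr (volume.restrict Ω) (fun x => ‖E x‖)) +
                Z.N (rearr (μH[(n : ℝ) - 1].restrict (frontier Ω)) (fun x => ‖u x‖))) := by
  obtain ⟨c, K, hc, hK, hrearr⟩ := exists_rearr_le_hardy hn hα1 hCμ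
  refine ⟨max 1 c * (K * (2 * C)), by positivity, ?_⟩
  intro Ω hΩ μ hμΩ hμ X Y Z h₁ h₂ h₃ u E hE hu _
  set ρE := rearr (volume.restrict Ω) fun x => ‖E x‖ with hρE
  set ρu := rearr (μH[(n : ℝ) - 1].restrict (frontier Ω)) fun x => ‖u x‖ with hρu
  have hE₁ := h₁ ρE fun s t _ h => rearr_antitone _ _ h
  have hE₂ := h₂ ρE fun s t _ h => rearr_antitone _ _ h
  have hu₃ := h₃ ρu fun s t _ h => rearr_antitone _ _ h
  set T₁ := hardyAverage (((n : ℝ) - 1) / α) (n / α) ρE with hT₁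
  set T₂ := hardyTail (((n : ℝ) - 1) / n) (n / α) ρE with hT₂
  set T₃ := hardyAverage (((n : ℝ) - 1) / α) (((n : ℝ) - 1) / α) ρu with hT₃
  have hE₁' : Y.N T₁ ≤ ENNReal.ofReal C * X.N ρE := hE₁
  have hE₂' : Y.N T₂ ≤ ENNReal.ofReal C * X.N ρE := hE₂
  have hu₃' : Y.N T₃ ≤ ENNReal.ofReal C * Z.N ρu := hu₃
  set H : ℝ → ℝ≥0∞ := fun s => ENNReal.ofReal K * (T₁ s + T₂ s + T₃ s) with hH
  calc Y.N (rearr μ fun x => ‖u x‖) ≤ Y.N fun s => H (c⁻¹ * s) := by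
        refine Y.mono _ _ fun s hs => ?_
        have := hrearr Ω hΩ μ hμΩ hμ u E hE hu (c⁻¹ * s) (by positivity)
        rwa [mul_inv_cancel_left₀ hc.ne'] at this
    _ ≤ ENNReal.ofReal (max 1 c) * Y.N H := by
        simpa using Y.dilate c⁻¹ (inv_pos.2 hc) H
    _ ≤ ENNReal.ofReal (max 1 c) * (ENNReal.ofReal K * (Y.N T₁ + Y.N T₂ + Y.N T₃)) := by
        gcongr
        refine (Y.smul_le _ _).trans (mul_le_mul_right ?_ _)
        exact (Y.add_le _ _).trans (add_le_add (Y.add_le _ _) le_rfl)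
    _ ≤ ENNReal.ofReal (max 1 c) * (ENNReal.ofReal K *
          (ENNReal.ofReal (2 * C) * (X.N ρE + Z.N ρu))) := by
        refine mul_le_mul_right (mul_le_mul_right ?_ _) _
        calc Y.N T₁ + Y.N T₂ + Y.N T₃
            ≤ ENNReal.ofReal C * X.N ρE + ENNReal.ofReal C * X.N ρE +
              (ENNReal.ofReal C * Z.N ρu + ENNReal.ofReal C * Z.N ρu) :=
              add_le_add (add_le_add hE₁' hE₂') (hu₃'.trans le_self_add)
          _ = _ := by
              rw [ENNReal.ofReal_mul (by norm_num), ENNReal.ofReal_ofNat]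
              ring
    _ = _ := by
        rw [ENNReal.ofReal_mul (p := max 1 c) (q := K * (2 * C)) (by positivity),
          ENNReal.ofReal_mul (p := K) (q := 2 * C) hK.le, mul_assoc, mul_assoc]

end
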